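/- arXiv:1510.08116 — 11 statements merged into one kernel-verified Lean document; each statement's English description precedes it below -/
import Mathlib

section
/- Every finite-dimensional simple module over the Jordan-plane Jacobi algebra J_J has dimension one over ℂ. -/
open FreeAlgebra

/-- The defining relations of the Jordan-plane Jacobi algebra `J_J`:
the quotient of the free algebra `ℂ⟨x,y,z⟩` by the two-sided ideal generated by
`x*y − y*x − y*y`, `y*z − z*y` and `z*x − x*z − 2*y*z`. -/
inductive JordanRel : FreeAlgebra ℂ (Fin 3) → FreeAlgebra ℂ (Fin 3) → Prop
  | xy : JordanRel (ι ℂ (0 : Fin 3) * ι ℂ 1 - ι ℂ 1 * ι ℂ 0 - ι ℂ 1 * ι ℂ 1) 0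
  | yz : JordanRel (ι ℂ (1 : Fin 3) * ι ℂ 2 - ι ℂ 2 * ι ℂ 1) 0
  | zx : JordanRel (ι ℂ (2 : Fin 3) * ι ℂ 0 - ι ℂ 0 * ι ℂ 2 - 2 * (ι ℂ 1 * ι ℂ 2)) 0

/-- The Jordan-plane Jacobi algebra `J_J`. -/
abbrev JordanAlg : Type := RingQuot JordanRel

theorem jordan_aux
    (M : Type) [AddCommGroup M] [Module JordanAlg M]
    [Module ℂ M] [IsScalarTower ℂ JordanAlg M]
    [IsSimpleModule JordanAlg M] (f : Fin 3 → Module.End ℂ M)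
    (hf : ∀ i m, f i m = (RingQuot.mkAlgHom ℂ JordanRel (ι ℂ i)) • m)
    (N : Submodule ℂ M) (hN : ∀ i, ∀ m ∈ N, f i m ∈ N) : N = ⊥ ∨ N = ⊤ := by
  have key : ∀ a : FreeAlgebra ℂ (Fin 3), ∀ m ∈ N,
      (RingQuot.mkAlgHom ℂ JordanRel a) • m ∈ N := by
    intro a
    induction a using FreeAlgebra.induction with
    | grade0 r =>
      intro m hm
      rw [AlgHom.commutes, algebraMap_smul]
      exact N.smul_mem r hm
    | grade1 i =>
      intro m hm
      rw [← hf]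
      exact hN i m hm
    | mul a b ha hb =>
      intro m hm
      rw [map_mul, mul_smul]
      exact ha _ (hb _ hm)
    | add a b ha hb =>
      intro m hm
      rw [map_add, add_smul]
      exact N.add_mem (ha _ hm) (hb _ hm)
  let P : Submodule JordanAlg M :=
    { carrier := N
      add_mem' := fun h h' => N.add_mem h h'
      zero_mem' := N.zero_mem
      smul_mem' := by
        intro c m hm
        obtain ⟨a, rfl⟩ := RingQuot.mkAlgHom_surjective ℂ JordanRel c
        exact key a m hm }
  have hP : ∀ m, m ∈ P ↔ m ∈ N := fun m => Iff.rfl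
  rcases eq_bot_or_eq_top P with h | h
  · left
    ext m
    rw [← hP, h]; simp
  · right
    ext m
    rw [← hP, h]; simp

/-- Every finite-dimensional simple module over the Jordan-plane Jacobi algebra
has dimension one over `ℂ`. -/
theorem finrank_eq_one_of_simple_jordan
    (M : Type) [AddCommGroup M] [Module JordanAlg M]
    [Module ℂ M] [IsScalarTower ℂ JordanAlg M] [FiniteDimensional ℂ M]
    [IsSimpleModule JordanAlg M] :
    Module.finrank ℂ M = 1 := by
  have hnt : Nontrivial M := IsSimpleModule.nontrivial JordanAlg M
  let F : FreeAlgebra ℂ (Fin 3) →ₐ[ℂ] Module.End ℂ M :=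
    (Algebra.lsmul ℂ ℂ M).comp (RingQuot.mkAlgHom ℂ JordanRel)
  let f : Fin 3 → Module.End ℂ M := fun i => F (ι ℂ i)
  have aux := jordan_aux M f (fun i m => rfl)
  have hrel : ∀ a b, JordanRel a b → F a = F b := by
    intro a b h
    simp only [F, AlgHom.comp_apply]
    rw [RingQuot.mkAlgHom_rel ℂ h]
  have h1 : f 0 * f 1 - f 1 * f 0 - f 1 * f 1 = 0 := by
    simpa [f] using hrel _ _ JordanRel.xy
  have h2 : f 1 * f 2 - f 2 * f 1 = 0 := by
    simpa [f] using hrel _ _ JordanRel.yz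
  have h3 : f 2 * f 0 - f 0 * f 2 - F 2 * (f 1 * f 2) = 0 := by
    simpa [f] using hrel _ _ JordanRel.zx
  clear_value f
  have e1 : ∀ m, f 0 (f 1 m) - f 1 (f 0 m) - f 1 (f 1 m) = 0 := fun m => by
    simpa using LinearMap.congr_fun h1 m
  have e2 : ∀ m, f 1 (f 2 m) - f 2 (f 1 m) = 0 := fun m => by
    simpa using LinearMap.congr_fun h2 m
  have y0 : f 1 = 0 := by
    rcases aux (LinearMap.ker (f 1)) (by
      intro i m hm
      rw [LinearMap.mem_ker] at hm ⊢
      fin_cases i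
      · have := e1 m
        simpa [hm] using this
      · simp [hm]
      · have := e2 m
        simpa [hm] using this) with h | h
    · exfalso
      have hu : IsUnit (f 1) := (LinearMap.isUnit_iff_ker_eq_bot _).2 h
      obtain ⟨u, hu⟩ := hu
      rw [← hu] at h1
      have h4 : (f 0) * (↑u⁻¹ : Module.End ℂ M) - ↑u⁻¹ * f 0 = -1 := by
        have : (↑u⁻¹ : Module.End ℂ M) * (f 0 * u - u * f 0 - u * u) * ↑u⁻¹ = 0 := by
          rw [h1]; simp
        simp only [mul_sub, sub_mul, mul_assoc, Units.mul_inv, mul_one, Units.inv_mul_cancel_left,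
          Units.inv_mul] at this
        rw [← neg_sub, neg_inj]
        exact sub_eq_zero.1 this
      have h5 := congrArg (LinearMap.trace ℂ M) h4
      rw [map_sub, LinearMap.trace_mul_comm, sub_self, map_neg, LinearMap.trace_one] at h5
      have : Module.finrank ℂ M ≠ 0 := Module.finrank_pos.ne'
      simp at h5
      exact this h5
    · exact LinearMap.ker_eq_top.1 h
  have h3' : f 2 * f 0 = f 0 * f 2 := by
    rw [y0] at h3
    simpa [sub_eq_zero] using h3
  have hcomm : ∀ i j, f i * f j = f j * f i := by
    intro i j
    fin_cases i <;> fin_cases j <;> simp [y0, h3']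
  have hsc : ∀ j, ∃ c : ℂ, ∀ m, f j m = c • m := by
    intro j
    obtain ⟨c, hc⟩ := Module.End.exists_eigenvalue (f j)
    refine ⟨c, fun m => ?_⟩
    rcases aux (Module.End.eigenspace (f j) c) (by
      intro i m hm
      rw [Module.End.mem_eigenspace_iff] at hm ⊢
      have := LinearMap.congr_fun (hcomm j i) m
      simp only [Module.End.mul_apply] at this
      rw [this, hm, map_smul]) with h | h
    · exact absurd h hc
    · rw [← Module.End.mem_eigenspace_iff, h]; trivial
  obtain ⟨v, hv⟩ := exists_ne (0 : M)
  rcases aux (Submodule.span ℂ {v}) (by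
    intro i m hm
    obtain ⟨c, hc⟩ := hsc i
    rw [hc]
    exact Submodule.smul_mem _ _ hm) with h | h
  · exact absurd (Submodule.span_singleton_eq_bot.1 h) hv
  · rw [← finrank_top ℂ M, ← h, finrank_span_singleton hv]
end

section
/- Every finite-dimensional simple module over the homogenized Weyl algebra J_hW has dimension one over ℂ. -/
open FreeAlgebra

/-- The defining relations of the homogenized Weyl algebra `J_hW`:
the quotient of the free algebra `ℂ⟨x,y,z⟩` by the two-sided ideal generated by
`x*y − y*x − z*z`, `x*z − z*x` and `y*z − z*y`. -/
inductive HomWeylRel : FreeAlgebra ℂ (Fin 3) → FreeAlgebra ℂ (Fin 3) → Prop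
  | xy : HomWeylRel (ι ℂ (0 : Fin 3) * ι ℂ 1 - ι ℂ 1 * ι ℂ 0 - ι ℂ 2 * ι ℂ 2) 0
  | xz : HomWeylRel (ι ℂ (0 : Fin 3) * ι ℂ 2 - ι ℂ 2 * ι ℂ 0) 0
  | yz : HomWeylRel (ι ℂ (1 : Fin 3) * ι ℂ 2 - ι ℂ 2 * ι ℂ 1) 0

/-- The homogenized Weyl algebra `J_hW`. -/
abbrev HomWeylAlg : Type := RingQuot HomWeylRel

theorem hw_inv (M : Type) [AddCommGroup M] [Module HomWeylAlg M]
    [Module ℂ M] [IsScalarTower ℂ HomWeylAlg M] [IsSimpleModule HomWeylAlg M]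
    (p : Submodule ℂ M)
    (hp : ∀ i : Fin 3, ∀ m ∈ p, RingQuot.mkAlgHom ℂ HomWeylRel (ι ℂ i) • m ∈ p) (hne : p ≠ ⊥) :
    p = ⊤ := by
  have key : ∀ a : FreeAlgebra ℂ (Fin 3), ∀ m ∈ p, RingQuot.mkAlgHom ℂ HomWeylRel a • m ∈ p := by
    intro a
    induction a using FreeAlgebra.induction with
    | grade0 r =>
      intro m hm
      rw [AlgHom.commutes, algebraMap_smul]
      exact p.smul_mem r hm
    | grade1 i => exact hp i
    | mul a b ha hb =>
      intro m hm
      rw [map_mul, mul_smul]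
      exact ha _ (hb _ hm)
    | add a b ha hb =>
      intro m hm
      rw [map_add, add_smul]
      exact p.add_mem (ha _ hm) (hb _ hm)
  let q : Submodule HomWeylAlg M :=
    { carrier := p
      add_mem' := fun h1 h2 => p.add_mem h1 h2
      zero_mem' := p.zero_mem
      smul_mem' := fun a m hm => by
        obtain ⟨b, rfl⟩ := RingQuot.mkAlgHom_surjective ℂ HomWeylRel a
        exact key b m hm }
  rcases eq_bot_or_eq_top q with h | h
  · exfalso
    apply hne
    rw [eq_bot_iff]
    intro m hm
    have : m ∈ q := hm
    rw [h] at this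
    simpa using this
  · rw [eq_top_iff]
    intro m _
    have : m ∈ q := by rw [h]; trivial
    exact this

/-- An operator commuting with all generators is a scalar. -/
theorem hw_scalar (M : Type) [AddCommGroup M] [Module HomWeylAlg M]
    [Module ℂ M] [IsScalarTower ℂ HomWeylAlg M] [FiniteDimensional ℂ M]
    [IsSimpleModule HomWeylAlg M] (g : HomWeylAlg)
    (hg : ∀ i : Fin 3, ∀ m : M, g • RingQuot.mkAlgHom ℂ HomWeylRel (ι ℂ i) • m
      = RingQuot.mkAlgHom ℂ HomWeylRel (ι ℂ i) • g • m) :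
    ∃ c : ℂ, ∀ m : M, g • m = c • m := by
  have : Nontrivial M := IsSimpleModule.nontrivial HomWeylAlg M
  let G : Module.End ℂ M := Algebra.lsmul ℂ ℂ M g
  obtain ⟨c, hc⟩ := Module.End.exists_eigenvalue G
  refine ⟨c, fun m => ?_⟩
  have ht : Module.End.eigenspace G c = ⊤ := by
    apply hw_inv M _ _ hc
    intro i m hm
    rw [Module.End.mem_eigenspace_iff] at hm ⊢
    change g • m = c • m at hm
    change g • (RingQuot.mkAlgHom ℂ HomWeylRel (ι ℂ i) • m) = c • (RingQuot.mkAlgHom ℂ HomWeylRel (ι ℂ i) • m)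
    rw [hg, hm, smul_comm]
  have hm : m ∈ Module.End.eigenspace G c := by rw [ht]; trivial
  exact Module.End.mem_eigenspace_iff.1 hm

/-- Every finite-dimensional simple module over the homogenized Weyl algebra
has dimension one over `ℂ`. -/
theorem finrank_eq_one_of_simple_homWeyl
    (M : Type) [AddCommGroup M] [Module HomWeylAlg M]
    [Module ℂ M] [IsScalarTower ℂ HomWeylAlg M] [FiniteDimensional ℂ M]
    [IsSimpleModule HomWeylAlg M] :
    Module.finrank ℂ M = 1 := by
  have : Nontrivial M := IsSimpleModule.nontrivial HomWeylAlg M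
  let φ := RingQuot.mkAlgHom ℂ HomWeylRel
  have hxy : φ (ι ℂ 0) * φ (ι ℂ 1) - φ (ι ℂ 1) * φ (ι ℂ 0) - φ (ι ℂ 2) * φ (ι ℂ 2) = 0 := by
    simpa using RingQuot.mkAlgHom_rel ℂ HomWeylRel.xy
  have hxz : φ (ι ℂ 0) * φ (ι ℂ 2) = φ (ι ℂ 2) * φ (ι ℂ 0) := by
    simpa [sub_eq_zero] using RingQuot.mkAlgHom_rel ℂ HomWeylRel.xz
  have hyz : φ (ι ℂ 1) * φ (ι ℂ 2) = φ (ι ℂ 2) * φ (ι ℂ 1) := by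
    simpa [sub_eq_zero] using RingQuot.mkAlgHom_rel ℂ HomWeylRel.yz
  obtain ⟨c, hc⟩ := hw_scalar M (φ (ι ℂ 2)) (by
    intro i m
    change φ (ι ℂ 2) • φ (ι ℂ i) • m = φ (ι ℂ i) • φ (ι ℂ 2) • m
    rw [← mul_smul, ← mul_smul]
    fin_cases i
    · exact congrArg (· • m) hxz.symm
    · exact congrArg (· • m) hyz.symm
    · rfl)
  have hc0 : c = 0 := by
    let L := Algebra.lsmul ℂ ℂ M (A := HomWeylAlg)
    have hz : L (φ (ι ℂ 2)) = c • 1 := by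
      ext m
      exact hc m
    have h := congrArg (fun a => LinearMap.trace ℂ M (L a)) hxy
    simp only [map_sub, map_mul, hz, map_zero] at h
    rw [LinearMap.trace_mul_comm ℂ (L (φ (ι ℂ 0)))] at h
    simpa [Module.finrank_pos.ne'] using h
  subst hc0
  have hcomm : ∀ m : M, φ (ι ℂ 0) • φ (ι ℂ 1) • m = φ (ι ℂ 1) • φ (ι ℂ 0) • m := by
    intro m
    have h := congrArg (· • m) hxy
    simp only [sub_smul, mul_smul, hc, zero_smul, sub_zero] at h
    exact sub_eq_zero.1 h
  have hz0 : ∀ m : M, φ (ι ℂ 2) • m = 0 := fun m => by rw [hc, zero_smul]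
  obtain ⟨a, ha⟩ := hw_scalar M (φ (ι ℂ 0)) (by
    intro i m
    change φ (ι ℂ 0) • φ (ι ℂ i) • m = φ (ι ℂ i) • φ (ι ℂ 0) • m
    fin_cases i
    · rfl
    · exact hcomm m
    · change φ (ι ℂ 0) • φ (ι ℂ 2) • m = φ (ι ℂ 2) • φ (ι ℂ 0) • m
      rw [hz0, hz0, smul_zero])
  obtain ⟨b, hb⟩ := hw_scalar M (φ (ι ℂ 1)) (by
    intro i m
    change φ (ι ℂ 1) • φ (ι ℂ i) • m = φ (ι ℂ i) • φ (ι ℂ 1) • m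
    fin_cases i
    · exact (hcomm m).symm
    · rfl
    · change φ (ι ℂ 1) • φ (ι ℂ 2) • m = φ (ι ℂ 2) • φ (ι ℂ 1) • m
      rw [hz0, hz0, smul_zero])
  obtain ⟨v, hv⟩ := exists_ne (0 : M)
  have ht : Submodule.span ℂ {v} = ⊤ := by
    apply hw_inv M
    · intro i m hm
      fin_cases i
      · exact (ha m).symm ▸ Submodule.smul_mem _ a hm
      · exact (hb m).symm ▸ Submodule.smul_mem _ b hm
      · exact (hc m).symm ▸ Submodule.smul_mem _ 0 hm
    · simpa using hv
  rw [← finrank_top, ← ht, finrank_span_singleton hv]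
end

section
/- Let q ∈ ℂ with q ≠ 0, and let J_q be the coordinate ring of quantum affine three-space. If V is a finite-dimensional simple J_q-module whose dimension r over ℂ satisfies r > 1, then q is a primitive r-th root of unity. -/
open FreeAlgebra

/-- The defining relations of quantum affine three-space `J_q`:
the quotient of the free algebra `ℂ⟨x,y,z⟩` by the two-sided ideal generated by
`x*y − q*y*x`, `y*z − q*z*y` and `z*x − q*x*z`. -/
inductive QuantumRel (q : ℂ) : FreeAlgebra ℂ (Fin 3) → FreeAlgebra ℂ (Fin 3) → Prop
  | xy : QuantumRel q (ι ℂ (0 : Fin 3) * ι ℂ 1 - q • (ι ℂ 1 * ι ℂ 0)) 0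
  | yz : QuantumRel q (ι ℂ (1 : Fin 3) * ι ℂ 2 - q • (ι ℂ 2 * ι ℂ 1)) 0
  | zx : QuantumRel q (ι ℂ (2 : Fin 3) * ι ℂ 0 - q • (ι ℂ 0 * ι ℂ 2)) 0

/-- The coordinate ring of quantum affine three-space. -/
abbrev QuantumAffineSpace (q : ℂ) : Type := RingQuot (QuantumRel q)

namespace QAS

variable {V : Type} [AddCommGroup V] [Module ℂ V]

/-- Irreducibility of a triple of operators. -/
def Irr (X Y Z : Module.End ℂ V) : Prop :=
  ∀ W : Submodule ℂ V, (∀ w ∈ W, X w ∈ W) → (∀ w ∈ W, Y w ∈ W) → (∀ w ∈ W, Z w ∈ W) →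
    W = ⊥ ∨ W = ⊤

lemma Irr.rot {X Y Z : Module.End ℂ V} (h : Irr X Y Z) : Irr Y Z X :=
  fun W a b c => h W c a b

/-- Schur. -/
lemma schur [FiniteDimensional ℂ V] [Nontrivial V] {X Y Z : Module.End ℂ V} (h : Irr X Y Z)
    (T : Module.End ℂ V) (hX : ∀ v, T (X v) = X (T v)) (hY : ∀ v, T (Y v) = Y (T v))
    (hZ : ∀ v, T (Z v) = Z (T v)) : ∃ c : ℂ, ∀ v, T v = c • v := by
  obtain ⟨c, hc⟩ := Module.End.exists_eigenvalue T
  refine ⟨c, ?_⟩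
  have := h (Module.End.eigenspace T c) ?_ ?_ ?_
  · rcases this with h0 | h1
    · exact absurd h0 hc
    · intro v
      have : v ∈ Module.End.eigenspace T c := by rw [h1]; trivial
      exact Module.End.mem_eigenspace_iff.1 this
  all_goals
    intro w hw
    rw [Module.End.mem_eigenspace_iff] at hw ⊢
    simp [hX, hY, hZ, hw]

lemma comm_case [FiniteDimensional ℂ V] [Nontrivial V] {X Y Z : Module.End ℂ V} (h : Irr X Y Z)
    (hX : X = 0) (hY : Y = 0) : Module.finrank ℂ V ≤ 1 := by
  subst hX hY
  obtain ⟨c, hc⟩ := schur h Z (by simp) (by simp) (by simp)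
  obtain ⟨v, hv⟩ := exists_ne (0 : V)
  have := h (ℂ ∙ v) (by simp) (by simp) (fun w hw => by rw [hc]; exact Submodule.smul_mem _ _ hw)
  rcases this with h0 | h1
  · exact absurd (Submodule.span_singleton_eq_bot.1 h0) hv
  · rw [← finrank_top ℂ V, ← h1]
    exact (finrank_span_singleton hv).le

lemma inj {q : ℂ} (hq : q ≠ 0) {X Y Z : Module.End ℂ V} (h : Irr X Y Z)
    (hxy : ∀ v, X (Y v) = q • Y (X v)) (hzx : ∀ v, Z (X v) = q • X (Z v)) (hX : X ≠ 0) :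
    ∀ v, X v = 0 → v = 0 := by
  have := h (LinearMap.ker X) ?_ ?_ ?_
  · rcases this with h0 | h1
    · intro v hv
      have : v ∈ LinearMap.ker X := hv
      rw [h0] at this
      simpa using this
    · exact absurd (LinearMap.ker_eq_top.1 h1) hX
  · intro w hw
    simp_all
  · intro w hw
    simp_all
  · intro w hw
    have h1 := hzx w
    have hw' : X w = 0 := hw
    rw [hw', map_zero] at h1
    exact (smul_eq_zero.1 h1.symm).resolve_left hq

lemma core [FiniteDimensional ℂ V] [Nontrivial V] {q : ℂ} (hq : q ≠ 0)
    {X Y Z : Module.End ℂ V} (h : Irr X Y Z)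
    (hxy : ∀ v, X (Y v) = q • Y (X v)) (hyz : ∀ v, Y (Z v) = q • Z (Y v))
    (hzx : ∀ v, Z (X v) = q • X (Z v)) (hX : X ≠ 0) (hY : Y ≠ 0) :
    IsPrimitiveRoot q (Module.finrank ℂ V) := by
  have iX := inj hq h hxy hzx hX
  have iY := inj hq h.rot hyz hxy hY
  have dX : LinearMap.det X ≠ 0 := by
    intro h0
    obtain ⟨v, hv, hv0⟩ := Submodule.exists_mem_ne_zero_of_ne_bot
      (bot_lt_iff_ne_bot.1 (LinearMap.bot_lt_ker_of_det_eq_zero h0))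
    exact hv0 (iX v hv)
  have dY : LinearMap.det Y ≠ 0 := by
    intro h0
    obtain ⟨v, hv, hv0⟩ := Submodule.exists_mem_ne_zero_of_ne_bot
      (bot_lt_iff_ne_bot.1 (LinearMap.bot_lt_ker_of_det_eq_zero h0))
    exact hv0 (iY v hv)
  have hqr : q ^ Module.finrank ℂ V = 1 := by
    have h1 : X * Y = q • (Y * X) := by ext v; simpa using hxy v
    have h2 := congrArg LinearMap.det h1
    rw [LinearMap.det_smul, map_mul, map_mul] at h2
    have h3 : (q ^ Module.finrank ℂ V - 1) * (LinearMap.det X * LinearMap.det Y) = 0 := by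
      linear_combination -h2
    rcases mul_eq_zero.1 h3 with h4 | h4
    · linear_combination h4
    · simp_all
  have hdvd : orderOf q ∣ Module.finrank ℂ V := orderOf_dvd_of_pow_eq_one hqr
  have hrpos : 0 < Module.finrank ℂ V := Module.finrank_pos
  have hnpos : 0 < orderOf q := Nat.pos_of_dvd_of_pos hdvd hrpos
  have hn : q ^ orderOf q = 1 := pow_orderOf_eq_one q
  suffices hle : Module.finrank ℂ V ≤ orderOf q by
    have : Module.finrank ℂ V = orderOf q := le_antisymm hle (Nat.le_of_dvd hrpos hdvd)
    rw [this]
    exact IsPrimitiveRoot.orderOf q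
  generalize orderOf q = n at *
  -- powers of Y
  have xyk : ∀ (k : ℕ) v, X ((Y ^ k) v) = q ^ k • (Y ^ k) (X v) := by
    intro k
    induction k with
    | zero => simp
    | succ k ih =>
      intro v
      rw [pow_succ', Module.End.mul_apply, hxy, ih, Module.End.mul_apply, map_smul, smul_smul,
        pow_succ']
  have ykz : ∀ (k : ℕ) v, (Y ^ k) (Z v) = q ^ k • Z ((Y ^ k) v) := by
    intro k
    induction k with
    | zero => simp
    | succ k ih =>
      intro v
      rw [pow_succ', Module.End.mul_apply, ih, Module.End.mul_apply, map_smul, hyz, smul_smul,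
        pow_succ]
  obtain ⟨m, hm⟩ := schur h (Y ^ n) (fun v => by rw [xyk, hn, one_smul])
    (fun v => by rw [← Module.End.mul_apply, ← Module.End.mul_apply, ← pow_succ, ← pow_succ'])
    (fun v => by rw [ykz, hn, one_smul])
  have iYk : ∀ (k : ℕ) v, (Y ^ k) v = 0 → v = 0 := by
    intro k
    induction k with
    | zero => simp
    | succ k ih =>
      intro v hv
      rw [pow_succ', Module.End.mul_apply] at hv
      exact ih v (iY _ hv)
  obtain ⟨c, hc⟩ := schur h (X * Y * Z)
    (fun v => by
      simp only [Module.End.mul_apply]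
      rw [hzx, map_smul Y, ← hxy])
    (fun v => by
      simp only [Module.End.mul_apply]
      rw [hyz v, map_smul, map_smul, ← hxy])
    (fun v => by
      simp only [Module.End.mul_apply]
      rw [hzx, ← map_smul, ← hyz])
  obtain ⟨l, hl⟩ := Module.End.exists_eigenvalue X
  obtain ⟨v, hv⟩ := hl.exists_hasEigenvector
  have hv0 := hv.2
  have hXv : X v = l • v := Module.End.mem_eigenspace_iff.1 hv.1
  have hl0 : l ≠ 0 := by
    rintro rfl
    exact hv0 (iX v (by simpa using hXv))
  have hm0 : m ≠ 0 := by
    rintro rfl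
    exact hv0 (iYk n v (by simpa using hm v))
  let W : Submodule ℂ V := Submodule.span ℂ (Set.range fun i : Fin n => (Y ^ (i : ℕ)) v)
  have hfin : Module.finrank ℂ W ≤ n := by
    simpa [Set.finrank] using finrank_range_le_card (R := ℂ) (fun i : Fin n => (Y ^ (i : ℕ)) v)
  have hmem : ∀ k : ℕ, k < n → (Y ^ k) v ∈ W := fun k hk =>
    Submodule.subset_span ⟨⟨k, hk⟩, rfl⟩
  have hind : ∀ T : Module.End ℂ V, (∀ k < n, T ((Y ^ k) v) ∈ W) → ∀ w ∈ W, T w ∈ W := by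
    intro T hT
    have : W ≤ W.comap T := by
      refine Submodule.span_le.2 ?_
      rintro _ ⟨i, rfl⟩
      exact hT i i.2
    exact this
  have WX : ∀ w ∈ W, X w ∈ W := hind X fun k hk => by
    rw [xyk, hXv, map_smul]
    exact W.smul_mem _ (W.smul_mem _ (hmem k hk))
  have WY : ∀ w ∈ W, Y w ∈ W := hind Y fun k hk => by
    rw [← Module.End.mul_apply, ← pow_succ']
    rcases Nat.lt_or_ge (k + 1) n with h1 | h1
    · exact hmem _ h1
    · have : k + 1 = n := by omega
      rw [this, hm]
      exact W.smul_mem _ (by simpa using hmem 0 hnpos)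
  have WZ : ∀ w ∈ W, Z w ∈ W := by
    intro w hw
    have hsub : W.map (X * Y) ≤ W := by
      rintro _ ⟨u, hu, rfl⟩
      exact WX _ (WY _ hu)
    have hinj : Function.Injective (X * Y) := by
      refine (injective_iff_map_eq_zero (X * Y)).2 fun u hu => iY _ (iX _ hu)
    have heq : W.map (X * Y) = W := by
      apply Submodule.eq_of_le_of_finrank_eq hsub
      exact (Submodule.equivMapOfInjective (X * Y) hinj W).finrank_eq.symm
    have hcw : c • w ∈ W.map (X * Y) := by rw [heq]; exact W.smul_mem _ hw
    obtain ⟨u, hu, huw⟩ := hcw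
    rw [← hc w, Module.End.mul_apply (X * Y) Z w] at huw
    rw [← hinj huw]
    exact hu
  rcases h W WX WY WZ with h0 | h1
  · have := hmem 0 hnpos
    rw [h0] at this
    exact absurd (by simpa using this) hv0
  · rw [h1, finrank_top] at hfin
    exact hfin

end QAS

/-- If `q ≠ 0` and `V` is a finite-dimensional simple `J_q`-module of dimension
`r > 1` over `ℂ`, then `q` is a primitive `r`-th root of unity. -/
theorem isPrimitiveRoot_of_simple_module_quantumAffineSpace
    (q : ℂ) (hq : q ≠ 0)
    (V : Type) [AddCommGroup V] [Module (QuantumAffineSpace q) V]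
    [Module ℂ V] [IsScalarTower ℂ (QuantumAffineSpace q) V] [FiniteDimensional ℂ V]
    [IsSimpleModule (QuantumAffineSpace q) V]
    (hr : 1 < Module.finrank ℂ V) :
    IsPrimitiveRoot q (Module.finrank ℂ V) := by
  have : SMulCommClass (QuantumAffineSpace q) ℂ V := IsScalarTower.to_smulCommClass'
  have : Nontrivial V := Module.nontrivial_of_finrank_pos (R := ℂ) (by omega)
  let π := RingQuot.mkAlgHom ℂ (QuantumRel q)
  let f : Fin 3 → Module.End ℂ V := fun i => Algebra.lsmul ℂ ℂ V (π (ι ℂ i))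
  have hf : ∀ i v, f i v = π (ι ℂ i) • v := fun i v => rfl
  have key : ∀ i j, QuantumRel q (ι ℂ i * ι ℂ j - q • (ι ℂ j * ι ℂ i)) 0 →
      ∀ v, f i (f j v) = q • f j (f i v) := by
    intro i j hij v
    have h1 := RingQuot.mkAlgHom_rel ℂ hij
    rw [map_sub, map_smul, map_mul, map_mul, map_zero, sub_eq_zero] at h1
    simp only [hf]
    rw [← mul_smul, ← mul_smul, ← smul_assoc]
    exact congrArg (· • v) h1
  have hxy := key 0 1 .xy
  have hyz := key 1 2 .yz
  have hzx := key 2 0 .zx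
  have hirr : QAS.Irr (f 0) (f 1) (f 2) := by
    intro W h0 h1 h2
    have hall : ∀ i : Fin 3, ∀ w ∈ W, f i w ∈ W := by
      intro i; fin_cases i <;> assumption
    have hs : ∀ (a : FreeAlgebra ℂ (Fin 3)), ∀ w ∈ W, π a • w ∈ W := by
      intro a
      induction a using FreeAlgebra.induction with
      | grade0 r =>
        intro w hw
        rw [AlgHom.commutes, algebraMap_smul]
        exact W.smul_mem _ hw
      | grade1 i => exact hall i
      | mul a b ha hb =>
        intro w hw
        rw [map_mul, mul_smul]
        exact ha _ (hb _ hw)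
      | add a b ha hb =>
        intro w hw
        rw [map_add, add_smul]
        exact W.add_mem (ha _ hw) (hb _ hw)
    let W' : Submodule (QuantumAffineSpace q) V :=
      { W.toAddSubmonoid with
        smul_mem' := by
          intro a w hw
          obtain ⟨b, rfl⟩ := RingQuot.mkAlgHom_surjective ℂ (QuantumRel q) a
          exact hs b w hw }
    have hW' : ∀ w, w ∈ W' ↔ w ∈ W := fun w => Iff.rfl
    rcases eq_bot_or_eq_top W' with h | h
    · left
      ext w
      rw [← hW', h]; simp
    · right
      ext w
      rw [← hW', h]; simp
  by_cases a0 : f 0 = 0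
  · by_cases a1 : f 1 = 0
    · have := QAS.comm_case hirr a0 a1
      omega
    · by_cases a2 : f 2 = 0
      · have := QAS.comm_case hirr.rot.rot a2 a0
        omega
      · exact QAS.core hq hirr.rot hyz hzx hxy a1 a2
  · by_cases a1 : f 1 = 0
    · by_cases a2 : f 2 = 0
      · have := QAS.comm_case hirr.rot a1 a2
        omega
      · exact QAS.core hq hirr.rot.rot hzx hxy hyz a2 a0
    · exact QAS.core hq hirr hxy hyz hzx a0 a1
end

section
/- Let r > 1 and let q ∈ ℂ be a primitive r-th root of unity. Then the coordinate ring J_q of quantum affine three-space admits a simple module whose dimension over ℂ equals r. -/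
open FreeAlgebra

noncomputable section

namespace QASProof

/-- Eigenvalues. -/
def dvec (r : ℕ) (q : ℂ) : ZMod r → ℂ := fun i => q ^ i.val

/-- The diagonal operator. -/
def opX (r : ℕ) (q : ℂ) : Module.End ℂ (ZMod r → ℂ) := Algebra.lmul ℂ (ZMod r → ℂ) (dvec r q)

/-- The shift operator. -/
def opY (r : ℕ) : Module.End ℂ (ZMod r → ℂ) := LinearMap.funLeft ℂ ℂ (fun i : ZMod r => i - 1)

lemma dvec_step (r : ℕ) (hr : 1 < r) (q : ℂ) (hq : IsPrimitiveRoot q r) (i : ZMod r) :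
    dvec r q i = q * dvec r q (i - 1) := by
  have : NeZero r := ⟨by omega⟩
  have : Fact (1 < r) := ⟨hr⟩
  obtain ⟨j, rfl⟩ : ∃ j, i = j + 1 := ⟨i - 1, by ring⟩
  simp only [dvec, add_sub_cancel_right]
  rw [ZMod.val_add, ZMod.val_one]
  have : q ^ ((j.val + 1) % r) = q ^ (j.val + 1) := by
    have h := pow_mod_orderOf q (j.val + 1)
    rwa [← hq.eq_orderOf] at h
  rw [this, pow_succ, mul_comm]

lemma dvec_inj (r : ℕ) (hr : 1 < r) (q : ℂ) (hq : IsPrimitiveRoot q r) :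
    Function.Injective (dvec r q) := by
  have : NeZero r := ⟨by omega⟩
  intro i j h
  exact ZMod.val_injective r (hq.pow_inj (ZMod.val_lt i) (ZMod.val_lt j) h)

/-- The representation on the free algebra. -/
def rep0 (r : ℕ) (q : ℂ) : FreeAlgebra ℂ (Fin 3) →ₐ[ℂ] Module.End ℂ (ZMod r → ℂ) :=
  FreeAlgebra.lift ℂ ![opX r q, opY r, 0]

lemma rep0_rel (r : ℕ) (hr : 1 < r) (q : ℂ) (hq : IsPrimitiveRoot q r)
    ⦃a b : FreeAlgebra ℂ (Fin 3)⦄ (h : QuantumRel q a b) : rep0 r q a = rep0 r q b := by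
  cases h with
  | xy =>
    simp only [rep0, map_sub, map_mul, map_smul, FreeAlgebra.lift_ι_apply, map_zero]
    ext1 f
    ext i
    simp only [Matrix.cons_val_zero, Matrix.cons_val_one]
    simp [opX, opY, LinearMap.funLeft_apply, dvec_step r hr q hq i]
    ring
  | yz => simp [rep0]
  | zx => simp [rep0]

/-- The representation. -/
def rep (r : ℕ) (hr : 1 < r) (q : ℂ) (hq : IsPrimitiveRoot q r) :
    QuantumAffineSpace q →ₐ[ℂ] Module.End ℂ (ZMod r → ℂ) :=
  RingQuot.liftAlgHom ℂ ⟨rep0 r q, rep0_rel r hr q hq⟩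

lemma exists_x (r : ℕ) (hr : 1 < r) (q : ℂ) (hq : IsPrimitiveRoot q r) :
    ∃ x, rep r hr q hq x = opX r q :=
  ⟨RingQuot.mkAlgHom ℂ _ (ι ℂ 0), by simp [rep, rep0]⟩

lemma exists_y (r : ℕ) (hr : 1 < r) (q : ℂ) (hq : IsPrimitiveRoot q r) :
    ∃ y, rep r hr q hq y = opY r :=
  ⟨RingQuot.mkAlgHom ℂ _ (ι ℂ 1), by simp [rep, rep0]⟩

lemma aeval_opX (r : ℕ) (q : ℂ) (p : Polynomial ℂ) (f : ZMod r → ℂ) (i : ZMod r) :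
    (Polynomial.aeval (opX r q) p) f i = p.eval (dvec r q i) * f i := by
  rw [opX, Polynomial.aeval_algHom_apply]
  have : (Polynomial.aeval (dvec r q) p) i = p.eval (dvec r q i) := by
    have := Polynomial.aeval_algHom_apply (Pi.evalAlgHom ℂ (fun _ : ZMod r => ℂ) i) (dvec r q) p
    simpa using this.symm
  simp [this]

lemma key (r : ℕ) (hr : 1 < r) (q : ℂ) (hq : IsPrimitiveRoot q r)
    (N : Submodule ℂ (ZMod r → ℂ)) (hN : ∀ a, ∀ f ∈ N, rep r hr q hq a f ∈ N)
    (f : ZMod r → ℂ) (hf : f ∈ N) (hf0 : f ≠ 0) (g : ZMod r → ℂ) : g ∈ N := by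
  have : NeZero r := ⟨by omega⟩
  obtain ⟨x, hx⟩ := exists_x r hr q hq
  obtain ⟨y, hy⟩ := exists_y r hr q hq
  obtain ⟨i, hi⟩ := Function.ne_iff.mp hf0
  have h1 : Pi.single i (1 : ℂ) ∈ N := by
    let p : Polynomial ℂ := ∏ j ∈ Finset.univ.erase i, (Polynomial.X - Polynomial.C (dvec r q j))
    have hp : ∀ j, j ≠ i → p.eval (dvec r q j) = 0 := by
      intro j hj
      rw [Polynomial.eval_prod]
      exact Finset.prod_eq_zero (i := j) (by simp [hj]) (by simp)
    have hpi : p.eval (dvec r q i) ≠ 0 := by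
      rw [Polynomial.eval_prod]
      refine Finset.prod_ne_zero_iff.mpr fun j hj => ?_
      simp only [Polynomial.eval_sub, Polynomial.eval_X, Polynomial.eval_C]
      exact sub_ne_zero.mpr fun h => (Finset.ne_of_mem_erase hj) (dvec_inj r hr q hq h).symm
    have h := N.smul_mem (p.eval (dvec r q i) * f i)⁻¹ (hN (Polynomial.aeval x p) f hf)
    rw [← Polynomial.aeval_algHom_apply, hx] at h
    convert h using 1
    ext j
    rw [Pi.smul_apply, aeval_opX]
    by_cases hj : j = i
    · subst hj
      have : p.eval (dvec r q j) * f j ≠ 0 := mul_ne_zero hpi hi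
      rw [Pi.single_eq_same, smul_eq_mul, inv_mul_cancel₀ this]
    · simp [hp j hj, hj]
  have h2 : ∀ k : ℕ, Pi.single (i + k) (1 : ℂ) ∈ N := by
    intro k
    induction k with
    | zero => simpa using h1
    | succ k ih =>
      have h := hN y _ ih
      rw [hy] at h
      convert h using 1
      ext j
      simp only [opY, LinearMap.funLeft_apply, Pi.single_apply]
      congr 1
      rw [sub_eq_iff_eq_add]
      push_cast
      rw [add_assoc]
  have h3 : ∀ j, Pi.single j (1 : ℂ) ∈ N := by
    intro j
    have := h2 (j - i).val
    rwa [ZMod.natCast_zmod_val, add_sub_cancel] at this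
  rw [pi_eq_sum_univ' g]
  refine N.sum_mem fun j _ => N.smul_mem _ ?_
  convert h3 j using 1

end QASProof

end

/-- If `r > 1` and `q` is a primitive `r`-th root of unity, then `J_q` admits a
simple module whose dimension over `ℂ` equals `r`. -/
theorem exists_simple_module_quantumAffineSpace_of_isPrimitiveRoot
    (r : ℕ) (hr : 1 < r) (q : ℂ) (hq : IsPrimitiveRoot q r) :
    ∃ (M : Type) (_ : AddCommGroup M) (_ : Module (QuantumAffineSpace q) M)
      (_ : Module ℂ M) (_ : IsScalarTower ℂ (QuantumAffineSpace q) M),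
      IsSimpleModule (QuantumAffineSpace q) M ∧ Module.finrank ℂ M = r := by
  have : NeZero r := ⟨by omega⟩
  let m : Module (QuantumAffineSpace q) (ZMod r → ℂ) :=
    Module.compHom _ (QASProof.rep r hr q hq).toRingHom
  have hs : ∀ (a : QuantumAffineSpace q) (f : ZMod r → ℂ),
    m.toSMul.smul a f = QASProof.rep r hr q hq a f := fun _ _ => rfl
  have tower : @IsScalarTower ℂ (QuantumAffineSpace q) (ZMod r → ℂ) _ m.toSMul _ := by
    refine @IsScalarTower.mk _ _ _ _ m.toSMul _ fun c a f => ?_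
    change QASProof.rep r hr q hq (c • a) f = c • QASProof.rep r hr q hq a f
    rw [map_smul]; rfl
  refine ⟨ZMod r → ℂ, inferInstance, m, inferInstance, tower, ?_, ?_⟩
  · refine @IsSimpleModule.mk _ _ _ _ m ?_
    refine @IsSimpleOrder.mk _ _ _ ?_ ?_
    · refine ⟨⊥, ⊤, fun h => ?_⟩
      have h1 : (1 : ZMod r → ℂ) ∈ (⊥ : @Submodule (QuantumAffineSpace q) (ZMod r → ℂ) _ _ m) := by
        rw [h]; trivial
      rw [Submodule.mem_bot] at h1
      exact one_ne_zero h1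
    · intro N
      by_cases hN : N = ⊥
      · exact Or.inl hN
      · right
        obtain ⟨f, hf, hf0⟩ := (Submodule.ne_bot_iff N).mp hN
        rw [eq_top_iff]
        intro g _
        exact QASProof.key r hr q hq
          { carrier := N, add_mem' := N.add_mem, zero_mem' := N.zero_mem,
            smul_mem' := fun c f hf => by
              have := N.smul_mem (algebraMap ℂ _ c) hf
              change QASProof.rep r hr q hq (algebraMap ℂ _ c) f ∈ N at this
              rw [AlgHom.commutes] at this
              exact this }
          (fun a f hf => N.smul_mem a hf) f hf hf0 g
  · rw [Module.finrank_fintype_fun_eq_card, ZMod.card]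
end

section
/- Let V be a finite-dimensional ℂ-vector space and let A, B be ℂ-linear endomorphisms of V satisfying A∘B − B∘A = B∘B. Then B is nilpotent. -/
open Polynomial in
theorem comm_aeval_aux {R : Type*} [Ring R] [Algebra ℂ R] (A B : R)
    (h : A * B - B * A = B * B) (p : ℂ[X]) :
    A * aeval B p - aeval B p * A = aeval B (derivative p) * (B * B) := by
  have hAB : A * B = B * A + B * B := by rw [← h]; abel
  induction p using Polynomial.induction_on with
  | C a => simp [Algebra.commutes]
  | add p q hp hq =>
    simp only [map_add, mul_add, add_mul]
    rw [← hp, ← hq]; abel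
  | monomial n a ih =>
    have e : (C a * X ^ (n + 1) : ℂ[X]) = (C a * X ^ n) * X := by ring
    rw [e]
    generalize (C a * X ^ n : ℂ[X]) = q at ih ⊢
    have hc : B * aeval B q = aeval B q * B := by
      have := congrArg (aeval B) (mul_comm X q)
      simpa using this
    have ih' : A * aeval B q = aeval B q * A + aeval B (derivative q) * (B * B) := by
      rw [← ih]; abel
    simp only [derivative_mul, derivative_X, mul_one, map_add, map_mul, aeval_X]
    rw [← mul_assoc, ih', add_mul, mul_assoc, hAB]
    noncomm_ring

open Polynomial in
theorem nilp_aux {R : Type*} [Ring R] [Algebra ℂ R] (A B : R)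
    (h : A * B - B * A = B * B) (n : ℕ) : ∀ (p : ℂ[X]) (k : ℕ), p.natDegree = n → p ≠ 0 →
    aeval B p * B ^ k = 0 → IsNilpotent B := by
  induction n with
  | zero =>
    intro p k hd hp h0
    rw [eq_C_of_natDegree_eq_zero hd] at h0 hp
    have hc : p.coeff 0 ≠ 0 := by simpa using hp
    refine ⟨k, ?_⟩
    rw [aeval_C, ← Algebra.smul_def] at h0
    have := congrArg (fun x => (p.coeff 0)⁻¹ • x) h0
    simpa [smul_smul, hc] using this
  | succ n ih =>
    intro p k hd hp h0
    have hd' : (derivative p).natDegree = n := by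
      rw [natDegree_derivative]; omega
    refine ih (derivative p) (k + 2) hd' ?_ ?_
    · intro hz
      have := natDegree_eq_zero_of_derivative_eq_zero hz
      omega
    · have h1 := comm_aeval_aux A B h p
      have h2 := comm_aeval_aux A B h (X ^ k)
      have h3 := comm_aeval_aux A B h (p * X ^ k)
      have hq : aeval B (p * X ^ k) = 0 := by simpa using h0
      rw [hq, derivative_mul] at h3
      have e : (derivative p * X ^ k + p * derivative (X ^ k)) * (X * X)
          = derivative p * X ^ (k + 2) + (C (k : ℂ) * X) * (p * X ^ k) := by
        rw [derivative_X_pow]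
        cases k with
        | zero => simp [pow_two]
        | succ k => simp; ring
      have e1 : aeval B ((derivative p * X ^ k + p * derivative (X ^ k)) * (X * X)) = 0 := by
        rw [map_mul, map_mul, aeval_X, ← h3]; simp
      rw [e, map_add, map_mul (aeval B) (C _ * _), hq, mul_zero, add_zero] at e1
      simpa using e1

/-- If `A`, `B` are endomorphisms of a finite-dimensional complex vector space with
`A∘B − B∘A = B∘B`, then `B` is nilpotent. -/
theorem isNilpotent_of_comm_eq_sq
    (V : Type) [AddCommGroup V] [Module ℂ V] [FiniteDimensional ℂ V]
    (A B : V →ₗ[ℂ] V) (h : A ∘ₗ B - B ∘ₗ A = B ∘ₗ B) :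
    IsNilpotent B := by
  refine nilp_aux (R := Module.End ℂ V) A B h _ (minpoly ℂ B) 0 rfl
    (minpoly.ne_zero (Algebra.IsIntegral.isIntegral (R := ℂ) (A := Module.End ℂ V) B)) ?_
  rw [minpoly.aeval, zero_mul]
end

section
/- Let V be a finite-dimensional ℂ-vector space, q ∈ ℂ with q ≠ 0, and let φ, ψ be ℂ-linear endomorphisms of V satisfying φ∘ψ = q·(ψ∘φ). Then there exist subspaces V₁, V₂, V₃, V₄ of V, each invariant under both φ and ψ, such that V is the internal direct sum V₁ ⊕ V₂ ⊕ V₃ ⊕ V₄, the restriction of φ is bijective on V₁ and V₂ and nilpotent on V₃ and V₄, and the restriction of ψ is bijective on V₁ and V₃ and nilpotent on V₂ and V₄. -/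
lemma qc_pow {V : Type} [AddCommGroup V] [Module ℂ V] (c : ℂ) (f g : V →ₗ[ℂ] V)
    (h : ∀ x, f (g x) = c • g (f x)) (n : ℕ) (x : V) :
    (f ^ n) (g x) = c ^ n • g ((f ^ n) x) := by
  induction n generalizing x with
  | zero => simp
  | succ k ih =>
    rw [pow_succ, Module.End.mul_apply, Module.End.mul_apply, h, map_smul, ih, smul_smul, pow_succ,
      mul_comm]

lemma qc_ker {V : Type} [AddCommGroup V] [Module ℂ V] (c : ℂ) (f g : V →ₗ[ℂ] V)
    (h : ∀ x, f (g x) = c • g (f x)) (n : ℕ) (x : V) (hx : x ∈ LinearMap.ker (f ^ n)) :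
    g x ∈ LinearMap.ker (f ^ n) := by
  rw [LinearMap.mem_ker] at hx ⊢
  rw [qc_pow c f g h, hx]; simp

lemma qc_range {V : Type} [AddCommGroup V] [Module ℂ V] (c : ℂ) (hc : c ≠ 0) (f g : V →ₗ[ℂ] V)
    (h : ∀ x, f (g x) = c • g (f x)) (n : ℕ) (x : V) (hx : x ∈ LinearMap.range (f ^ n)) :
    g x ∈ LinearMap.range (f ^ n) := by
  obtain ⟨y, rfl⟩ := hx
  refine ⟨(c ^ n)⁻¹ • g y, ?_⟩
  rw [map_smul, qc_pow c f g h, smul_smul, inv_mul_cancel₀ (pow_ne_zero _ hc), one_smul]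

lemma qc_inv_pow {V : Type} [AddCommGroup V] [Module ℂ V] (g : V →ₗ[ℂ] V) (S : Submodule ℂ V)
    (h : ∀ x ∈ S, g x ∈ S) (n : ℕ) (x : V) (hx : x ∈ S) : (g ^ n) x ∈ S := by
  induction n generalizing x with
  | zero => simpa
  | succ k ih => rw [pow_succ, Module.End.mul_apply]; exact ih _ (h _ hx)

lemma qc_bij {V : Type} [AddCommGroup V] [Module ℂ V] [FiniteDimensional ℂ V] (f : V →ₗ[ℂ] V)
    (n : ℕ) (hn : 1 ≤ n) (hd : ∀ x ∈ LinearMap.ker (f ^ n), x ∈ LinearMap.range (f ^ n) → x = 0)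
    (W : Submodule ℂ V) (hW : W ≤ LinearMap.range (f ^ n)) (hf : ∀ x ∈ W, f x ∈ W) :
    Function.Bijective (f.restrict hf) := by
  have hi : Function.Injective (f.restrict hf) := by
    rw [injective_iff_map_eq_zero]
    intro x hx
    have hx' : f x = 0 := congrArg Subtype.val hx
    apply Subtype.ext
    refine hd _ ?_ (hW x.2)
    obtain ⟨k, rfl⟩ := Nat.exists_eq_add_of_le' hn
    rw [LinearMap.mem_ker, pow_succ, Module.End.mul_apply, hx', map_zero]
  exact ⟨hi, LinearMap.injective_iff_surjective.mp hi⟩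

lemma qc_nil {V : Type} [AddCommGroup V] [Module ℂ V] (f : V →ₗ[ℂ] V)
    (n : ℕ) (W : Submodule ℂ V) (hW : W ≤ LinearMap.ker (f ^ n)) (hf : ∀ x ∈ W, f x ∈ W) :
    IsNilpotent (f.restrict hf) := by
  refine ⟨n, ?_⟩
  rw [Module.End.pow_restrict]
  ext x
  exact hW x.2

lemma qc_internal {V : Type} [AddCommGroup V] [Module ℂ V] (W : Fin 4 → Submodule ℂ V)
    (h1 : ∀ x, ∃ a ∈ W 0, ∃ b ∈ W 1, ∃ c ∈ W 2, ∃ d ∈ W 3, x = a + b + c + d)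
    (h2 : ∀ a ∈ W 0, ∀ b ∈ W 1, ∀ c ∈ W 2, ∀ d ∈ W 3, a + b + c + d = 0 →
      a = 0 ∧ b = 0 ∧ c = 0 ∧ d = 0) : DirectSum.IsInternal W := by
  classical
  have key : ∀ x : DirectSum (Fin 4) (fun i => W i), DirectSum.coeAddMonoidHom W x =
      (x 0 : V) + x 1 + x 2 + x 3 := by
    intro x
    rw [DirectSum.coeAddMonoidHom_eq_dfinsuppSum, DFinsupp.sum_eq_sum_fintype]
    · simp [Fin.sum_univ_four]
    · simp
  constructor
  · rw [injective_iff_map_eq_zero]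
    intro x hx
    rw [key] at hx
    obtain ⟨e0, e1, e2, e3⟩ := h2 _ (x 0).2 _ (x 1).2 _ (x 2).2 _ (x 3).2 hx
    refine DFinsupp.ext fun i => ?_
    apply Subtype.ext
    fin_cases i
    · exact e0
    · exact e1
    · exact e2
    · exact e3
  · intro x
    obtain ⟨a, ha, b, hb, c, hc, d, hd, rfl⟩ := h1 x
    refine ⟨DirectSum.of (fun i => W i) 0 ⟨a, ha⟩ + DirectSum.of (fun i => W i) 1 ⟨b, hb⟩
      + DirectSum.of (fun i => W i) 2 ⟨c, hc⟩ + DirectSum.of (fun i => W i) 3 ⟨d, hd⟩, ?_⟩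
    simp only [map_add, DirectSum.coeAddMonoidHom_of]

/-- A pair of endomorphisms `φ`, `ψ` of a finite-dimensional complex vector space
with `φ∘ψ = q·ψ∘φ`, `q ≠ 0`, admits a canonical decomposition
`V = V₁ ⊕ V₂ ⊕ V₃ ⊕ V₄` into subspaces invariant under both `φ` and `ψ`, with `φ`
bijective on `V₁, V₂` and nilpotent on `V₃, V₄`, and `ψ` bijective on `V₁, V₃` and
nilpotent on `V₂, V₄`. -/
theorem qCommute_exists_decomposition
    (V : Type) [AddCommGroup V] [Module ℂ V] [FiniteDimensional ℂ V]
    (q : ℂ) (hq : q ≠ 0) (φ ψ : V →ₗ[ℂ] V)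
    (h : φ ∘ₗ ψ = q • (ψ ∘ₗ φ)) :
    ∃ (W : Fin 4 → Submodule ℂ V)
      (hφ : ∀ i, ∀ x ∈ W i, φ x ∈ W i)
      (hψ : ∀ i, ∀ x ∈ W i, ψ x ∈ W i),
      DirectSum.IsInternal W ∧
      Function.Bijective (φ.restrict (hφ 0)) ∧
      Function.Bijective (φ.restrict (hφ 1)) ∧
      IsNilpotent (φ.restrict (hφ 2)) ∧
      IsNilpotent (φ.restrict (hφ 3)) ∧
      Function.Bijective (ψ.restrict (hψ 0)) ∧
      IsNilpotent (ψ.restrict (hψ 1)) ∧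
      Function.Bijective (ψ.restrict (hψ 2)) ∧
      IsNilpotent (ψ.restrict (hψ 3)) := by
  have h1 : ∀ x, φ (ψ x) = q • ψ (φ x) := fun x => LinearMap.congr_fun h x
  have h2 : ∀ x, ψ (φ x) = q⁻¹ • φ (ψ x) := fun x => by
    rw [h1, smul_smul, inv_mul_cancel₀ hq, one_smul]
  have h3 : ∀ (f : V →ₗ[ℂ] V) x, f (f x) = (1 : ℂ) • f (f x) := fun f x => (one_smul _ _).symm
  obtain ⟨n, ⟨hA, hB⟩, hn⟩ := ((φ.eventually_isCompl_ker_pow_range_pow.and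
    ψ.eventually_isCompl_ker_pow_range_pow).and (Filter.eventually_ge_atTop 1)).exists
  have dA := Submodule.disjoint_def.mp hA.disjoint
  have dB := Submodule.disjoint_def.mp hB.disjoint
  have kφφ := qc_ker 1 φ φ (h3 φ) n
  have kψψ := qc_ker 1 ψ ψ (h3 ψ) n
  have kφψ := qc_ker q φ ψ h1 n
  have kψφ := qc_ker q⁻¹ ψ φ h2 n
  have rφφ := qc_range 1 one_ne_zero φ φ (h3 φ) n
  have rψψ := qc_range 1 one_ne_zero ψ ψ (h3 ψ) n
  have rφψ := qc_range q hq φ ψ h1 n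
  have rψφ := qc_range q⁻¹ (inv_ne_zero hq) ψ φ h2 n
  have kB := qc_inv_pow ψ _ kφψ n
  have rB := qc_inv_pow ψ _ rφψ n
  have sA : ∀ x, ∃ a ∈ LinearMap.range (φ ^ n), ∃ b ∈ LinearMap.ker (φ ^ n), a + b = x := fun x =>
    Submodule.mem_sup.mp (hA.symm.sup_eq_top ▸ Submodule.mem_top)
  have sB : ∀ x, ∃ a ∈ LinearMap.range (ψ ^ n), ∃ b ∈ LinearMap.ker (ψ ^ n), a + b = x := fun x =>
    Submodule.mem_sup.mp (hB.symm.sup_eq_top ▸ Submodule.mem_top)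
  have uA : ∀ a ∈ LinearMap.range (φ ^ n), ∀ b ∈ LinearMap.ker (φ ^ n), a + b = 0 →
      a = 0 ∧ b = 0 := by
    intro a ha b hb hab
    have e : a = -b := eq_neg_of_add_eq_zero_left hab
    have : a = 0 := dA a (e ▸ Submodule.neg_mem _ hb) ha
    exact ⟨this, by simpa [this] using hab⟩
  have uB : ∀ a ∈ LinearMap.range (ψ ^ n), ∀ b ∈ LinearMap.ker (ψ ^ n), a + b = 0 →
      a = 0 ∧ b = 0 := by
    intro a ha b hb hab
    have e : a = -b := eq_neg_of_add_eq_zero_left hab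
    have : a = 0 := dB a (e ▸ Submodule.neg_mem _ hb) ha
    exact ⟨this, by simpa [this] using hab⟩
  refine ⟨![LinearMap.range (φ ^ n) ⊓ LinearMap.range (ψ ^ n),
    LinearMap.range (φ ^ n) ⊓ LinearMap.ker (ψ ^ n),
    LinearMap.ker (φ ^ n) ⊓ LinearMap.range (ψ ^ n),
    LinearMap.ker (φ ^ n) ⊓ LinearMap.ker (ψ ^ n)], ?_, ?_, ?_, ?_, ?_, ?_, ?_, ?_, ?_, ?_, ?_⟩
  · intro i
    fin_cases i
    · exact fun x hx => ⟨rφφ x hx.1, rψφ x hx.2⟩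
    · exact fun x hx => ⟨rφφ x hx.1, kψφ x hx.2⟩
    · exact fun x hx => ⟨kφφ x hx.1, rψφ x hx.2⟩
    · exact fun x hx => ⟨kφφ x hx.1, kψφ x hx.2⟩
  · intro i
    fin_cases i
    · exact fun x hx => ⟨rφψ x hx.1, rψψ x hx.2⟩
    · exact fun x hx => ⟨rφψ x hx.1, kψψ x hx.2⟩
    · exact fun x hx => ⟨kφψ x hx.1, rψψ x hx.2⟩
    · exact fun x hx => ⟨kφψ x hx.1, kψψ x hx.2⟩
  · apply qc_internal
    · intro x
      obtain ⟨_, ⟨u, rfl⟩, k, hk, rfl⟩ := sB x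
      obtain ⟨u1, hu1, u2, hu2, rfl⟩ := sA u
      obtain ⟨k1, hk1, k2, hk2, rfl⟩ := sA k
      have hk' : (ψ ^ n) k1 + (ψ ^ n) k2 = 0 := by rw [← map_add]; exact hk
      obtain ⟨e1, e2⟩ := uA _ (rB _ hk1) _ (kB _ hk2) hk'
      refine ⟨(ψ ^ n) u1, ⟨rB _ hu1, ⟨_, rfl⟩⟩, k1, ⟨hk1, e1⟩, (ψ ^ n) u2,
        ⟨kB _ hu2, ⟨_, rfl⟩⟩, k2, ⟨hk2, e2⟩, ?_⟩
      rw [map_add]; abel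
    · rintro a ⟨ha, ha'⟩ b ⟨hb, hb'⟩ c ⟨hc, hc'⟩ d ⟨hd, hd'⟩ e
      obtain ⟨e1, e2⟩ := uA (a + b) (add_mem ha hb) (c + d) (add_mem hc hd)
        (by rw [← e]; abel)
      obtain ⟨e3, e4⟩ := uB a ha' b hb' e1
      obtain ⟨e5, e6⟩ := uB c hc' d hd' e2
      exact ⟨e3, e4, e5, e6⟩
  · exact qc_bij φ n hn dA _ inf_le_left _
  · exact qc_bij φ n hn dA _ inf_le_left _
  · exact qc_nil φ n _ inf_le_left _
  · exact qc_nil φ n _ inf_le_left _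
  · exact qc_bij ψ n hn dB _ inf_le_right _
  · exact qc_nil ψ n _ inf_le_right _
  · exact qc_bij ψ n hn dB _ inf_le_right _
  · exact qc_nil ψ n _ inf_le_right _
end

section
/- Let V be a finite-dimensional ℂ-vector space, let A₀ be a nilpotent ℂ-linear endomorphism of V, and let q ∈ ℂ with q ≠ 0. Then there exists an invertible ℂ-linear endomorphism P of V with A₀∘P = q·(P∘A₀); and for any such invertible P, the map h ↦ h∘P is a bijection from the centralizer {h : h∘A₀ = A₀∘h} onto the set {B : A₀∘B = q·(B∘A₀)}, and this bijection restricts to a bijection between the invertible elements of the two sets. -/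
open Polynomial in
lemma twist_exists (σ : ℂ[X] ≃+* ℂ[X]) (c : ℂ[X]) (hc : IsUnit c) (hσ : σ X = c * X)
    (M : Type) [AddCommGroup M] [Module ℂ[X] M] [Module.Finite ℂ[X] M]
    (hM : Module.IsTorsion' M (Submonoid.powers (X : ℂ[X]))) :
    ∃ e : M ≃+ M, ∀ (r : ℂ[X]) (m : M), e (r • m) = σ r • e m := by
  classical
  obtain ⟨d, k, ⟨g⟩⟩ := Module.torsion_by_prime_power_decomposition
    (Polynomial.irreducible_X (R := ℂ)) hM
  have hI : ∀ i, (Ideal.span {(X : ℂ[X]) ^ k i}) =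
      (Ideal.span {(X : ℂ[X]) ^ k i}).map (σ : ℂ[X] →+* ℂ[X]) := by
    intro i
    rw [Ideal.map_span, Set.image_singleton]
    simp only [RingEquiv.coe_toRingHom, map_pow, hσ, mul_pow]
    rw [Ideal.span_singleton_mul_left_unit (hc.pow _)]
  let E : ∀ i, (ℂ[X] ⧸ (Ideal.span {(X : ℂ[X]) ^ k i})) ≃+* (ℂ[X] ⧸ (Ideal.span {(X : ℂ[X]) ^ k i})) :=
    fun i => Ideal.quotientEquiv _ _ σ (hI i)
  have hE : ∀ i (r : ℂ[X]) m, E i (r • m) = σ r • E i m := by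
    intro i r m
    obtain ⟨m, rfl⟩ := Ideal.Quotient.mk_surjective m
    change Ideal.Quotient.mk _ (σ (r * m)) = Ideal.Quotient.mk _ (σ r * σ m)
    rw [map_mul]
  let F : (DirectSum (Fin d) fun i => ℂ[X] ⧸ (Ideal.span {(X : ℂ[X]) ^ k i})) ≃+
      (DirectSum (Fin d) fun i => ℂ[X] ⧸ (Ideal.span {(X : ℂ[X]) ^ k i})) :=
    DFinsupp.mapRange.addEquiv (fun i => (E i).toAddEquiv)
  have hF : ∀ (r : ℂ[X]) m, F (r • m) = σ r • F m := by
    intro r m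
    refine DFinsupp.ext fun i => ?_
    exact hE i r (m i)
  refine ⟨(g.toAddEquiv.trans F).trans g.symm.toAddEquiv, fun r m => ?_⟩
  change g.symm (F (g (r • m))) = σ r • g.symm (F (g m))
  rw [map_smul, hF, map_smul]

open Polynomial in
lemma exists_twist (V : Type) [AddCommGroup V] [Module ℂ V] [FiniteDimensional ℂ V]
    (A : V →ₗ[ℂ] V) (hA : IsNilpotent A) (q : ℂ) (hq : q ≠ 0) :
    ∃ P : V ≃ₗ[ℂ] V, A ∘ₗ P.toLinearMap = q • (P.toLinearMap ∘ₗ A) := by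
  let σ : ℂ[X] ≃ₐ[ℂ] ℂ[X] := AlgEquiv.ofAlgHom (aeval (C q⁻¹ * X)) (aeval (C q * X))
    (by ext; simp [← mul_assoc, ← C_mul, hq]) (by ext; simp [← mul_assoc, ← C_mul, hq])
  have hσ : σ X = C q⁻¹ * X := by simp [σ]
  have hσC : ∀ c, σ (C c) = C c := fun c => σ.commutes c
  obtain ⟨n, hn⟩ := hA
  have hX : ∀ v : V, (X : ℂ[X]) • Module.AEval'.of A v = Module.AEval'.of A (A v) := fun v =>
    Module.AEval'.X_smul_of A v
  have hCs : ∀ (c : ℂ) (v : V), (C c : ℂ[X]) • Module.AEval'.of A v = Module.AEval'.of A (c • v) := by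
    intro c v
    rw [Module.AEval.C_smul, map_smul]
  obtain ⟨e, he⟩ := twist_exists σ.toRingEquiv (C q⁻¹)
    (isUnit_C.2 (inv_ne_zero hq).isUnit) hσ (Module.AEval' A) (by
      intro m
      refine ⟨⟨X ^ n, n, rfl⟩, ?_⟩
      obtain ⟨v, rfl⟩ := (Module.AEval'.of A).surjective m
      change (X ^ n : ℂ[X]) • (Module.AEval'.of A v) = 0
      rw [Module.AEval'.X_pow_smul_of, hn]
      simp)
  have he' : ∀ (r : ℂ[X]) m, e (r • m) = σ r • e m := he
  let o := Module.AEval'.of A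
  let P : V ≃ₗ[ℂ] V :=
    { (o.toAddEquiv.trans e).trans o.symm.toAddEquiv with
      map_smul' := by
        intro c v
        change o.symm (e (o (c • v))) = c • o.symm (e (o v))
        rw [← hCs, he', hσC, Module.AEval.C_smul, map_smul] }
  have hP : ∀ v, o (P v) = e (o v) := fun v => o.apply_symm_apply _
  refine ⟨P, ?_⟩
  ext v
  apply o.injective
  change o (A (P v)) = o (q • P (A v))
  rw [← hX, hP, ← hCs, hP, ← hX, he', hσ, smul_smul, ← mul_assoc, ← C_mul, mul_inv_cancel₀ hq,
    C_1, one_mul]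



/-- For a nilpotent `A₀` and `q ≠ 0`: there is an invertible `P` with
`A₀∘P = q·P∘A₀`; and for any such invertible `P`, the map `h ↦ h∘P` is a bijection
from the centralizer `{h : h∘A₀ = A₀∘h}` onto `{B : A₀∘B = q·B∘A₀}`, restricting to
a bijection between the invertible elements of the two sets. -/
theorem nilpotent_qCommute_trivialization
    (V : Type) [AddCommGroup V] [Module ℂ V] [FiniteDimensional ℂ V]
    (A₀ : V →ₗ[ℂ] V) (hA₀ : IsNilpotent A₀) (q : ℂ) (hq : q ≠ 0) :
    (∃ P : V ≃ₗ[ℂ] V,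
        A₀ ∘ₗ P.toLinearMap = q • (P.toLinearMap ∘ₗ A₀)) ∧
    (∀ P : V ≃ₗ[ℂ] V, A₀ ∘ₗ P.toLinearMap = q • (P.toLinearMap ∘ₗ A₀) →
      Set.BijOn (fun h : V →ₗ[ℂ] V => h ∘ₗ P.toLinearMap)
        {h | h ∘ₗ A₀ = A₀ ∘ₗ h}
        {B | A₀ ∘ₗ B = q • (B ∘ₗ A₀)} ∧
      Set.BijOn (fun h : V →ₗ[ℂ] V => h ∘ₗ P.toLinearMap)
        {h | h ∘ₗ A₀ = A₀ ∘ₗ h ∧ Function.Bijective h}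
        {B | A₀ ∘ₗ B = q • (B ∘ₗ A₀) ∧ Function.Bijective B}) := by
  refine ⟨exists_twist V A₀ hA₀ q hq, fun P hP => ?_⟩
  have hPv : ∀ v, A₀ (P v) = q • P (A₀ v) := fun v => LinearMap.congr_fun hP v
  have h1 : ∀ h : V →ₗ[ℂ] V, h ∘ₗ A₀ = A₀ ∘ₗ h →
      A₀ ∘ₗ (h ∘ₗ P.toLinearMap) = q • ((h ∘ₗ P.toLinearMap) ∘ₗ A₀) := by
    intro h hh
    ext v
    have := LinearMap.congr_fun hh (P v)
    simp only [LinearMap.comp_apply] at this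
    simp [← this, hPv]
  have h2 : ∀ B : V →ₗ[ℂ] V, A₀ ∘ₗ B = q • (B ∘ₗ A₀) →
      (B ∘ₗ P.symm.toLinearMap) ∘ₗ A₀ = A₀ ∘ₗ (B ∘ₗ P.symm.toLinearMap) := by
    intro B hB
    ext v
    obtain ⟨w, rfl⟩ := P.surjective v
    have := LinearMap.congr_fun hB w
    simp only [LinearMap.comp_apply, LinearMap.smul_apply] at this
    simp [this, hPv]
  have h3 : ∀ B : V →ₗ[ℂ] V, (B ∘ₗ P.symm.toLinearMap) ∘ₗ P.toLinearMap = B := by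
    intro B
    ext v
    simp
  have h4 : Function.Injective (fun h : V →ₗ[ℂ] V => h ∘ₗ P.toLinearMap) := by
    intro a b hab
    ext v
    have := LinearMap.congr_fun hab (P.symm v)
    simpa using this
  refine ⟨⟨fun h hh => h1 h hh, h4.injOn, fun B hB => ⟨_, h2 B hB, h3 B⟩⟩,
    ⟨fun h hh => ⟨h1 h hh.1, ?_⟩, h4.injOn, fun B hB => ⟨_, ⟨h2 B hB.1, ?_⟩, h3 B⟩⟩⟩
  · exact hh.2.comp P.bijective
  · exact hB.2.comp P.symm.bijective
end

section
/- Let V be a finite-dimensional ℂ-vector space and let B be a nilpotent ℂ-linear endomorphism of V. Then there exists a ℂ-linear endomorphism A of V with A∘B − B∘A = B∘B; moreover, for any such A₀, the set {A : A∘B − B∘A = B∘B} equals {A₀ + C : C∘B = B∘C}, i.e. it is a coset of the centralizer of B. -/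
theorem trace_left_zero_aux {V : Type} [AddCommGroup V] [Module ℂ V] [FiniteDimensional ℂ V]
    (C : Module.End ℂ V) (h : ∀ A : Module.End ℂ V, LinearMap.trace ℂ V (C * A) = 0) : C = 0 := by
  ext x
  rw [LinearMap.zero_apply, ← Module.forall_dual_apply_eq_zero_iff ℂ]
  intro f
  have h1 := h (LinearMap.smulRight f x)
  have h2 : C * (LinearMap.smulRight f x : V →ₗ[ℂ] V) = LinearMap.smulRight f (C x) := by
    ext y
    simp
  rw [h2, LinearMap.trace_smulRight] at h1
  exact h1

theorem exists_trace_rep_aux {V : Type} [AddCommGroup V] [Module ℂ V] [FiniteDimensional ℂ V]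
    (f : Module.End ℂ V →ₗ[ℂ] ℂ) :
    ∃ C : Module.End ℂ V, ∀ A, f A = LinearMap.trace ℂ V (C * A) := by
  let T : Module.End ℂ V →ₗ[ℂ] Module.Dual ℂ (Module.End ℂ V) :=
    (LinearMap.mul ℂ (Module.End ℂ V)).compr₂ (LinearMap.trace ℂ V)
  have hT : ∀ C A, T C A = LinearMap.trace ℂ V (C * A) := fun C A => rfl
  have hinj : Function.Injective T := by
    rw [injective_iff_map_eq_zero]
    intro C hC
    apply trace_left_zero_aux
    intro A
    rw [← hT, hC, LinearMap.zero_apply]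
  have hsurj := (LinearMap.injective_iff_surjective_of_finrank_eq_finrank
    (Subspace.dual_finrank_eq (K := ℂ) (V := Module.End ℂ V)).symm).1 hinj
  obtain ⟨C, hC⟩ := hsurj f
  exact ⟨C, fun A => by rw [← hT, hC]⟩

theorem exists_sol_aux {V : Type} [AddCommGroup V] [Module ℂ V] [FiniteDimensional ℂ V]
    (B : Module.End ℂ V) (hB : IsNilpotent B) :
    ∃ A : Module.End ℂ V, A * B - B * A = B * B := by
  let D : Module.End ℂ V →ₗ[ℂ] Module.End ℂ V := LinearMap.mulRight ℂ B - LinearMap.mulLeft ℂ B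
  have hD : ∀ A, D A = A * B - B * A := fun A => rfl
  suffices h : B * B ∈ LinearMap.range D by
    obtain ⟨A, hA⟩ := h
    exact ⟨A, hA⟩
  by_contra hn
  obtain ⟨f, hf, hle⟩ := Submodule.exists_le_ker_of_notMem hn
  obtain ⟨C, hC⟩ := exists_trace_rep_aux f
  have hcomm : B * C - C * B = 0 := by
    apply trace_left_zero_aux
    intro A
    have h0 : f (D A) = 0 := hle ⟨A, rfl⟩
    rw [hC, hD, mul_sub, map_sub, ← mul_assoc, ← mul_assoc, LinearMap.trace_mul_comm _ (C * A) B,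
      ← mul_assoc, ← map_sub, ← sub_mul] at h0
    exact h0
  have hc : Commute B C := sub_eq_zero.1 hcomm
  apply hf
  rw [hC]
  have hcc : Commute (C * B) B := hc.symm.mul_left (Commute.refl B)
  rw [← mul_assoc]
  exact (LinearMap.isNilpotent_trace_of_isNilpotent (hcc.isNilpotent_mul_left hB)).eq_zero

/-- For a nilpotent endomorphism `B` of a finite-dimensional complex vector space,
there exists `A` with `A∘B − B∘A = B∘B`; and for any such `A₀`, the solution set
`{A : A∘B − B∘A = B∘B}` equals the coset `A₀ + {centralizer of B}`. -/
theorem jordan_fiber_is_coset_of_centralizer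
    (V : Type) [AddCommGroup V] [Module ℂ V] [FiniteDimensional ℂ V]
    (B : V →ₗ[ℂ] V) (hB : IsNilpotent B) :
    (∃ A : V →ₗ[ℂ] V, A ∘ₗ B - B ∘ₗ A = B ∘ₗ B) ∧
    (∀ A₀ : V →ₗ[ℂ] V, A₀ ∘ₗ B - B ∘ₗ A₀ = B ∘ₗ B →
      {A : V →ₗ[ℂ] V | A ∘ₗ B - B ∘ₗ A = B ∘ₗ B} =
        (fun C => A₀ + C) '' {C : V →ₗ[ℂ] V | C ∘ₗ B = B ∘ₗ C}) := by
  refine ⟨exists_sol_aux B hB, ?_⟩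
  intro A₀ h₀
  ext A
  simp only [Set.mem_setOf_eq, Set.mem_image]
  constructor
  · intro hA
    refine ⟨A - A₀, ?_, by abel⟩
    rw [LinearMap.sub_comp, LinearMap.comp_sub, sub_eq_sub_iff_sub_eq_sub, hA, h₀]
  · rintro ⟨C, hC, rfl⟩
    rw [LinearMap.add_comp, LinearMap.comp_add, hC, add_sub_add_right_eq_sub, h₀]
end

section
/- Let λ, μ ∈ ℂ with μ ≠ 0 and λ³ ≠ −27·μ³, and let f = λ·XYZ + μ·(X³ + Y³ + Z³) in the polynomial ring ℂ[X, Y, Z]. Then the quotient of ℂ[X, Y, Z] by the ideal generated by the three partial derivatives ∂f/∂X, ∂f/∂Y, ∂f/∂Z is a ℂ-vector space of dimension 8. -/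
open MvPolynomial

/-- The cubic superpotential `f = λ·XYZ + μ·(X³ + Y³ + Z³)` in `ℂ[X, Y, Z]`. -/
noncomputable def sklyaninCubic (lam mu : ℂ) : MvPolynomial (Fin 3) ℂ :=
  C lam * (X 0 * X 1 * X 2) + C mu * (X 0 ^ 3 + X 1 ^ 3 + X 2 ^ 3)

section helpers

theorem skl_alg {Q : Type*} [CommRing Q] (x y z A B : Q)
    (hx : x ^ 2 = A * y * z) (hy : y ^ 2 = A * x * z) (hz : z ^ 2 = A * x * y)
    (hB : B * (1 - A ^ 3) = 1) :
    x ^ 2 * y = 0 ∧ x ^ 2 * z = 0 ∧ y ^ 2 * x = 0 ∧ y ^ 2 * z = 0 ∧ z ^ 2 * x = 0 ∧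
      z ^ 2 * y = 0 := by
  have key : ∀ w : Q, w = A ^ 3 * w → w = 0 := fun w hw => by
    linear_combination (-w) * hB + B * hw
  refine ⟨key _ ?_, key _ ?_, key _ ?_, key _ ?_, key _ ?_, key _ ?_⟩
  · linear_combination y * hx + A * z * hy + A ^ 2 * x * hz
  · linear_combination z * hx + A * y * hz + A ^ 2 * x * hy
  · linear_combination x * hy + A * z * hx + A ^ 2 * y * hz
  · linear_combination z * hy + A * x * hz + A ^ 2 * y * hx
  · linear_combination x * hz + A * y * hx + A ^ 2 * z * hy
  · linear_combination y * hz + A * x * hy + A ^ 2 * z * hx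

/-- candidate expansion in the monomial basis -/
noncomputable def sklSec : (Fin 8 → ℂ) →ₗ[ℂ] MvPolynomial (Fin 3) ℂ where
  toFun c := C (c 0) + C (c 1) * X 0 + C (c 2) * X 1 + C (c 3) * X 2
    + C (c 4) * (X 1 * X 2) + C (c 5) * (X 0 * X 2) + C (c 6) * (X 0 * X 1)
    + C (c 7) * (X 0 * X 1 * X 2)
  map_add' c d := by simp only [Pi.add_apply, C_add]; ring
  map_smul' r c := by
    simp only [Pi.smul_apply, smul_eq_mul, C_mul, smul_eq_C_mul, RingHom.id_apply]; ring

/-- evaluation at zero of a derivative -/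
noncomputable def sklD (a : ℂ) (p : MvPolynomial (Fin 3) ℂ) : Fin 8 → ℂ :=
  ![eval 0 p, eval 0 (pderiv 0 p), eval 0 (pderiv 1 p), eval 0 (pderiv 2 p),
    eval 0 (pderiv 1 (pderiv 2 p)) + a / 2 * eval 0 (pderiv 0 (pderiv 0 p)),
    eval 0 (pderiv 0 (pderiv 2 p)) + a / 2 * eval 0 (pderiv 1 (pderiv 1 p)),
    eval 0 (pderiv 0 (pderiv 1 p)) + a / 2 * eval 0 (pderiv 2 (pderiv 2 p)),
    eval 0 (pderiv 0 (pderiv 1 (pderiv 2 p))) + a / 6 * (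
      eval 0 (pderiv 0 (pderiv 0 (pderiv 0 p))) + eval 0 (pderiv 1 (pderiv 1 (pderiv 1 p)))
      + eval 0 (pderiv 2 (pderiv 2 (pderiv 2 p))))]

theorem sklD_sec (a : ℂ) (c : Fin 8 → ℂ) : sklD a (sklSec c) = c := by
  ext i
  fin_cases i <;>
  simp [sklD, sklSec, Derivation.leibniz, pderiv_X]

theorem sklD_add (a : ℂ) (p q : MvPolynomial (Fin 3) ℂ) :
    sklD a (p + q) = sklD a p + sklD a q := by
  ext i
  fin_cases i <;> simp [sklD] <;> ring

theorem sklD_mul0 (a : ℂ) (p : MvPolynomial (Fin 3) ℂ) :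
    sklD a (p * (X 0 * X 0 - C a * (X 1 * X 2))) = 0 := by
  ext i
  fin_cases i <;> simp [sklD, Derivation.leibniz, pderiv_X] <;> ring

theorem sklD_mul1 (a : ℂ) (p : MvPolynomial (Fin 3) ℂ) :
    sklD a (p * (X 1 * X 1 - C a * (X 0 * X 2))) = 0 := by
  ext i
  fin_cases i <;> simp [sklD, Derivation.leibniz, pderiv_X] <;> ring

theorem sklD_mul2 (a : ℂ) (p : MvPolynomial (Fin 3) ℂ) :
    sklD a (p * (X 2 * X 2 - C a * (X 0 * X 1))) = 0 := by
  ext i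
  fin_cases i <;> simp [sklD, Derivation.leibniz, pderiv_X] <;> ring

theorem skl_surj {Q : Type*} [CommRing Q] (π : MvPolynomial (Fin 3) ℂ →+* Q)
    (a : ℂ) (ha : a ^ 3 ≠ 1)
    (h0 : π (X 0 * X 0 - C a * (X 1 * X 2)) = 0)
    (h1 : π (X 1 * X 1 - C a * (X 0 * X 2)) = 0)
    (h2 : π (X 2 * X 2 - C a * (X 0 * X 1)) = 0) (p : MvPolynomial (Fin 3) ℂ) :
    ∃ c, π (sklSec c) = π p := by
  have hB : π (C (1 - a ^ 3)⁻¹) * (1 - π (C a) ^ 3) = 1 := by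
    have : (1 - a ^ 3) ≠ 0 := fun h => ha (by linear_combination -h)
    rw [← map_pow, ← map_one π, ← map_sub, ← map_mul, ← C_pow, ← C_1, ← C_sub, ← C_mul,
      inv_mul_cancel₀ this]
  simp only [map_sub, map_mul] at h0 h1 h2
  obtain ⟨e1, e2, e3, e4, e5, e6⟩ := skl_alg (π (X 0)) (π (X 1)) (π (X 2)) (π (C a)) _
    (by linear_combination h0) (by linear_combination h1) (by linear_combination h2) hB
  induction p using MvPolynomial.induction_on with
  | C r => exact ⟨![r, 0, 0, 0, 0, 0, 0, 0], by simp [sklSec]⟩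
  | add p q hp hq =>
    obtain ⟨c, hc⟩ := hp
    obtain ⟨d, hd⟩ := hq
    exact ⟨c + d, by simp only [map_add, hc, hd]⟩
  | mul_X p i hp =>
    obtain ⟨c, hc⟩ := hp
    rw [map_mul, ← hc]
    fin_cases i
    · refine ⟨![0, c 0, 0, 0, a * c 1, c 3, c 2, c 4], ?_⟩
      simp [sklSec]
      linear_combination -π (C (c 1)) * h0 - π (C (c 5)) * e2 - π (C (c 6)) * e1
        - π (C (c 7)) * π (X 2) * e1
    · refine ⟨![0, 0, c 0, 0, c 3, a * c 2, c 1, c 5], ?_⟩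
      simp [sklSec]
      linear_combination -π (C (c 2)) * h1 - π (C (c 4)) * e4 - π (C (c 6)) * e3
        - π (C (c 7)) * π (X 2) * e3
    · refine ⟨![0, 0, 0, c 0, c 2, c 1, a * c 3, c 6], ?_⟩
      simp [sklSec]
      linear_combination -π (C (c 3)) * h2 - π (C (c 4)) * e6 - π (C (c 5)) * e5
        - π (C (c 7)) * π (X 1) * e5

end helpers

/-- If `μ ≠ 0` and `λ³ ≠ −27μ³`, the quotient of `ℂ[X,Y,Z]` by the ideal generated
by the three partial derivatives of `f = λ·XYZ + μ·(X³+Y³+Z³)` is an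
8-dimensional `ℂ`-vector space. -/
theorem finrank_sklyaninCubic_jacobian_ring_eq_eight
    (lam mu : ℂ) (hmu : mu ≠ 0) (hsmooth : lam ^ 3 ≠ -27 * mu ^ 3) :
    Module.finrank ℂ
      (MvPolynomial (Fin 3) ℂ ⧸
        Ideal.span {pderiv (0 : Fin 3) (sklyaninCubic lam mu),
                    pderiv (1 : Fin 3) (sklyaninCubic lam mu),
                    pderiv (2 : Fin 3) (sklyaninCubic lam mu)}) = 8 := by
  obtain ⟨a, rfl⟩ : ∃ a, lam = -3 * mu * a := ⟨-lam / (3 * mu), by field_simp⟩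
  have ha : a ^ 3 ≠ 1 := fun h => hsmooth (by linear_combination (-27 * mu ^ 3) * h)
  have h3 : ∀ i, pderiv i (3 : MvPolynomial (Fin 3) ℂ) = 0 := fun i => pderiv_C (a := (3 : ℂ))
  have p0 : pderiv (0 : Fin 3) (sklyaninCubic (-3 * mu * a) mu) =
      C (3 * mu) * (X 0 * X 0 - C a * (X 1 * X 2)) := by
    simp [sklyaninCubic, Derivation.leibniz, Derivation.leibniz_pow, pderiv_X,
      C_mul, show (C 3 : MvPolynomial (Fin 3) ℂ) = 3 from rfl, h3]
    ring
  have p1 : pderiv (1 : Fin 3) (sklyaninCubic (-3 * mu * a) mu) =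
      C (3 * mu) * (X 1 * X 1 - C a * (X 0 * X 2)) := by
    simp [sklyaninCubic, Derivation.leibniz, Derivation.leibniz_pow, pderiv_X,
      C_mul, show (C 3 : MvPolynomial (Fin 3) ℂ) = 3 from rfl, h3]
    ring
  have p2 : pderiv (2 : Fin 3) (sklyaninCubic (-3 * mu * a) mu) =
      C (3 * mu) * (X 2 * X 2 - C a * (X 0 * X 1)) := by
    simp [sklyaninCubic, Derivation.leibniz, Derivation.leibniz_pow, pderiv_X,
      C_mul, show (C 3 : MvPolynomial (Fin 3) ℂ) = 3 from rfl, h3]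
    ring
  rw [p0, p1, p2]
  set I := Ideal.span {C (3 * mu) * (X 0 * X 0 - C a * (X 1 * X 2)),
    C (3 * mu) * (X 1 * X 1 - C a * (X 0 * X 2)),
    C (3 * mu) * (X 2 * X 2 - C a * (X 0 * X 1) : MvPolynomial (Fin 3) ℂ)} with hI
  have hu : ∀ g : MvPolynomial (Fin 3) ℂ, C (3 * mu) * g ∈ I → Ideal.Quotient.mk I g = 0 := by
    intro g hg
    rw [Ideal.Quotient.eq_zero_iff_mem]
    have := I.mul_mem_left (C (3 * mu)⁻¹) hg
    rwa [← mul_assoc, ← C_mul, inv_mul_cancel₀ (by simpa using hmu), C_1, one_mul] at this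
  let ψ : (Fin 8 → ℂ) →ₗ[ℂ] (MvPolynomial (Fin 3) ℂ ⧸ I) :=
    (Ideal.Quotient.mkₐ ℂ I).toLinearMap ∘ₗ sklSec
  have hψ : Function.Bijective ψ := by
    constructor
    · rw [← LinearMap.ker_eq_bot, LinearMap.ker_eq_bot']
      intro c hc
      have hc' : sklSec c ∈ I := Ideal.Quotient.eq_zero_iff_mem.1 hc
      rw [hI, Ideal.mem_span_insert] at hc'
      obtain ⟨u, w, hw, h⟩ := hc'
      rw [Ideal.mem_span_pair] at hw
      obtain ⟨v, t, rfl⟩ := hw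
      rw [← sklD_sec a c, h, sklD_add, sklD_add, ← mul_assoc u, ← mul_assoc v, ← mul_assoc t,
        sklD_mul0, sklD_mul1, sklD_mul2]
      simp
    · intro q
      obtain ⟨p, rfl⟩ := Ideal.Quotient.mk_surjective q
      exact skl_surj (Ideal.Quotient.mk I) a ha
        (hu _ (Ideal.subset_span (by simp))) (hu _ (Ideal.subset_span (by simp)))
        (hu _ (Ideal.subset_span (by simp))) p
  rw [← (LinearEquiv.ofBijective ψ hψ).finrank_eq]
  simp
end

section
/- Let V₁, V₂ be finite-dimensional ℂ-vector spaces, q ∈ ℂ with q ≠ 0, and let A : V₁ → V₂ and B₁, B₂ : V₂ → V₁ be ℂ-linear maps satisfying B₁∘A∘B₂ = q·(B₂∘A∘B₁). Then there exist subspace decompositions V₁ = V₁ᴺ ⊕ V₁ᴵ and V₂ = V₂ᴺ ⊕ V₂ᴵ such that A maps V₁ᴺ into V₂ᴺ and V₁ᴵ into V₂ᴵ, both B₁ and B₂ map V₂ᴺ into V₁ᴺ and V₂ᴵ into V₁ᴵ, the restriction of B₂∘A to V₁ᴺ is nilpotent and its restriction to V₁ᴵ is bijective, and the restriction of A∘B₂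 to V₂ᴺ is nilpotent and its restriction to V₂ᴵ is bijective. -/
theorem aux_pow {U W : Type} [AddCommGroup U] [Module ℂ U] [AddCommGroup W] [Module ℂ W]
    (f : U →ₗ[ℂ] W) (P : U →ₗ[ℂ] U) (Q : W →ₗ[ℂ] W) (c : ℂ)
    (h : ∀ x, f (P x) = c • Q (f x)) (n : ℕ) :
    ∀ x, f ((P ^ n) x) = c ^ n • (Q ^ n) (f x) := by
  induction n with
  | zero => intro x; simp
  | succ k ih =>
    intro x
    rw [pow_succ P, pow_succ Q, Module.End.mul_apply, Module.End.mul_apply, ih, h, map_smul,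
      smul_smul, pow_succ]

theorem aux_maps {U W : Type} [AddCommGroup U] [Module ℂ U] [AddCommGroup W] [Module ℂ W]
    (f : U →ₗ[ℂ] W) (P : U →ₗ[ℂ] U) (Q : W →ₗ[ℂ] W) (c : ℂ) (hc : c ≠ 0)
    (h : ∀ x, f (P x) = c • Q (f x)) (n : ℕ) :
    (∀ x ∈ LinearMap.ker (P ^ n), f x ∈ LinearMap.ker (Q ^ n)) ∧
    (∀ x ∈ LinearMap.range (P ^ n), f x ∈ LinearMap.range (Q ^ n)) := by
  have hp := aux_pow f P Q c h n
  constructor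
  · intro x hx
    rw [LinearMap.mem_ker] at hx ⊢
    have := hp x
    rw [hx, map_zero] at this
    exact (smul_eq_zero.mp this.symm).resolve_left (pow_ne_zero n hc)
  · rintro _ ⟨y, rfl⟩
    exact ⟨c ^ n • f y, by rw [map_smul, hp]⟩

theorem aux_restrict {U : Type} [AddCommGroup U] [Module ℂ U] [FiniteDimensional ℂ U]
    (P : U →ₗ[ℂ] U) (n : ℕ) (hn : 1 ≤ n)
    (hc : IsCompl (LinearMap.ker (P ^ n)) (LinearMap.range (P ^ n)))
    (hN : ∀ x ∈ LinearMap.ker (P ^ n), P x ∈ LinearMap.ker (P ^ n))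
    (hI : ∀ x ∈ LinearMap.range (P ^ n), P x ∈ LinearMap.range (P ^ n)) :
    IsNilpotent (P.restrict hN) ∧ Function.Bijective (P.restrict hI) := by
  constructor
  · refine ⟨n, ?_⟩
    rw [Module.End.pow_restrict n]
    ext x
    simpa using x.2
  · have hinj : Function.Injective (P.restrict hI) := by
      rw [← LinearMap.ker_eq_bot, LinearMap.ker_eq_bot']
      rintro ⟨x, hx⟩ h0
      have h1 : P x = 0 := congrArg Subtype.val h0
      have h2 : x ∈ LinearMap.ker (P ^ n) := by
        obtain ⟨m, rfl⟩ := Nat.exists_eq_add_of_le' hn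
        rw [LinearMap.mem_ker, pow_succ, Module.End.mul_apply, h1, map_zero]
      exact Subtype.ext (Submodule.disjoint_def.mp hc.disjoint x h2 hx)
    exact ⟨hinj, LinearMap.injective_iff_surjective.mp hinj⟩

/-- A representation `(A, B₁, B₂)` of the cut deformed-conifold quiver, i.e. linear
maps with `B₁∘A∘B₂ = q·B₂∘A∘B₁` and `q ≠ 0`, splits as a direct sum of a
subrepresentation on which `B₂∘A` (resp. `A∘B₂`) is nilpotent and one on which it
is bijective. -/
theorem deformed_conifold_cut_decomposition
    (V₁ V₂ : Type)
    [AddCommGroup V₁] [Module ℂ V₁] [FiniteDimensional ℂ V₁]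
    [AddCommGroup V₂] [Module ℂ V₂] [FiniteDimensional ℂ V₂]
    (q : ℂ) (hq : q ≠ 0)
    (A : V₁ →ₗ[ℂ] V₂) (B₁ B₂ : V₂ →ₗ[ℂ] V₁)
    (h : B₁ ∘ₗ A ∘ₗ B₂ = q • (B₂ ∘ₗ A ∘ₗ B₁)) :
    ∃ (W₁N W₁I : Submodule ℂ V₁) (W₂N W₂I : Submodule ℂ V₂)
      (_ : ∀ x ∈ W₁N, A x ∈ W₂N) (_ : ∀ x ∈ W₁I, A x ∈ W₂I)
      (_ : ∀ x ∈ W₂N, B₁ x ∈ W₁N) (_ : ∀ x ∈ W₂I, B₁ x ∈ W₁I)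
      (_ : ∀ x ∈ W₂N, B₂ x ∈ W₁N) (_ : ∀ x ∈ W₂I, B₂ x ∈ W₁I)
      (hN₁ : ∀ x ∈ W₁N, (B₂ ∘ₗ A) x ∈ W₁N) (hI₁ : ∀ x ∈ W₁I, (B₂ ∘ₗ A) x ∈ W₁I)
      (hN₂ : ∀ x ∈ W₂N, (A ∘ₗ B₂) x ∈ W₂N) (hI₂ : ∀ x ∈ W₂I, (A ∘ₗ B₂) x ∈ W₂I),
      IsCompl W₁N W₁I ∧ IsCompl W₂N W₂I ∧
      IsNilpotent ((B₂ ∘ₗ A).restrict hN₁) ∧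
      Function.Bijective ((B₂ ∘ₗ A).restrict hI₁) ∧
      IsNilpotent ((A ∘ₗ B₂).restrict hN₂) ∧
      Function.Bijective ((A ∘ₗ B₂).restrict hI₂) := by
  obtain ⟨n, ⟨h1, h2⟩, hn⟩ := (((B₂ ∘ₗ A).eventually_isCompl_ker_pow_range_pow.and
    (A ∘ₗ B₂).eventually_isCompl_ker_pow_range_pow).and (Filter.eventually_ge_atTop 1)).exists
  have hA := aux_maps A (B₂ ∘ₗ A) (A ∘ₗ B₂) 1 one_ne_zero (by simp) n
  have hB₂ := aux_maps B₂ (A ∘ₗ B₂) (B₂ ∘ₗ A) 1 one_ne_zero (by simp) n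
  have hB₁ := aux_maps B₁ (A ∘ₗ B₂) (B₂ ∘ₗ A) q hq (fun x => LinearMap.congr_fun h x) n
  have hN₁ := fun x hx => hB₂.1 _ (hA.1 x hx)
  have hI₁ := fun x hx => hB₂.2 _ (hA.2 x hx)
  have hN₂ := fun x hx => hA.1 _ (hB₂.1 x hx)
  have hI₂ := fun x hx => hA.2 _ (hB₂.2 x hx)
  have r1 := aux_restrict (B₂ ∘ₗ A) n hn h1 hN₁ hI₁
  have r2 := aux_restrict (A ∘ₗ B₂) n hn h2 hN₂ hI₂
  exact ⟨_, _, _, _, hA.1, hA.2, hB₁.1, hB₁.2, hB₂.1, hB₂.2, hN₁, hI₁, hN₂, hI₂,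
    h1, h2, r1.1, r1.2, r2.1, r2.2⟩
end

section
/- Let r ≥ 1, let q ∈ ℂ be a primitive r-th root of unity, and let V be a nonzero finite-dimensional ℂ-vector space carrying two invertible ℂ-linear endomorphisms A, B with A∘B = q·(B∘A), such that the only subspaces of V invariant under both A and B are the zero subspace and V itself. Then the dimension of V over ℂ equals r. -/
/-- A simple finite-dimensional module over the quantum torus at a primitive
`r`-th root of unity — i.e. a nonzero space with invertible endomorphisms `A`, `B`
satisfying `A∘B = q·B∘A` and no nontrivial common invariant subspaces — has
dimension exactly `r` over `ℂ`. -/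
theorem finrank_eq_order_of_simple_quantum_torus_module
    (r : ℕ) (hr : 1 ≤ r) (q : ℂ) (hq : IsPrimitiveRoot q r)
    (V : Type) [AddCommGroup V] [Module ℂ V] [FiniteDimensional ℂ V] [Nontrivial V]
    (A B : V →ₗ[ℂ] V)
    (hA : Function.Bijective A) (hB : Function.Bijective B)
    (h : A ∘ₗ B = q • (B ∘ₗ A))
    (hsimple : ∀ W : Submodule ℂ V,
      (∀ x ∈ W, A x ∈ W) → (∀ x ∈ W, B x ∈ W) → W = ⊥ ∨ W = ⊤) :
    Module.finrank ℂ V = r := by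
  have h' : ∀ x, A (B x) = q • B (A x) := fun x => by
    simpa using LinearMap.congr_fun h x
  have hpow : ∀ n : ℕ, ∀ x, A ((B ^ n) x) = q ^ n • (B ^ n) (A x) := by
    intro n
    induction n with
    | zero => intro x; simp
    | succ n ih =>
      intro x
      rw [pow_succ', Module.End.mul_apply, h', ih, map_smul, smul_smul, Module.End.mul_apply,
        pow_succ']
  obtain ⟨c, hc⟩ := Module.End.exists_eigenvalue (B ^ r)
  have htop : Module.End.eigenspace (B ^ r) c = ⊤ := by
    refine (hsimple (Module.End.eigenspace (B ^ r) c) ?_ ?_).resolve_left hc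
    · intro x hx
      rw [Module.End.mem_eigenspace_iff] at hx ⊢
      have := hpow r x
      rw [hq.pow_eq_one, one_smul, hx, map_smul] at this
      exact this.symm
    · intro x hx
      rw [Module.End.mem_eigenspace_iff] at hx ⊢
      rw [← Module.End.mul_apply, ← pow_succ, pow_succ', Module.End.mul_apply, hx, map_smul]
  have hBr : ∀ x, (B ^ r) x = c • x := fun x => by
    rw [← Module.End.mem_eigenspace_iff, htop]; trivial
  obtain ⟨m, hm⟩ := Module.End.exists_eigenvalue A
  obtain ⟨v, hv⟩ := hm.exists_hasEigenvector
  have hAv : A v = m • v := hv.apply_eq_smul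
  have hv0 : v ≠ 0 := hv.2
  have hm0 : m ≠ 0 := by
    rintro rfl
    rw [zero_smul] at hAv
    exact hv0 (hA.1 (by rw [hAv, map_zero]))
  have hBn : ∀ n : ℕ, Function.Injective (B ^ n : V →ₗ[ℂ] V) := fun n => by
    rw [Module.End.coe_pow]; exact hB.1.iterate n
  have hAe : ∀ n : ℕ, A ((B ^ n) v) = (q ^ n * m) • (B ^ n) v := fun n => by
    rw [hpow, hAv, map_smul, smul_smul]
  have hli : LinearIndependent ℂ (fun i : Fin r => (B ^ (i : ℕ)) v) := by
    refine Module.End.eigenvectors_linearIndependent' A (fun i : Fin r => q ^ (i : ℕ) * m) ?_ _ ?_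
    · intro i j hij
      exact Fin.ext (hq.pow_inj i.2 j.2 (mul_right_cancel₀ hm0 hij))
    · intro i
      refine ⟨Module.End.mem_eigenspace_iff.2 (hAe i), ?_⟩
      intro h0
      exact hv0 (hBn i (by rw [h0, map_zero]))
  have hspan : Submodule.span ℂ (Set.range (fun i : Fin r => (B ^ (i : ℕ)) v)) = ⊤ := by
    refine (hsimple _ ?_ ?_).resolve_left ?_
    · intro x hx
      refine (Submodule.span_le (p := (Submodule.span ℂ (Set.range
        (fun i : Fin r => (B ^ (i : ℕ)) v))).comap A)).2 ?_ hx
      rintro _ ⟨i, rfl⟩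
      simp only [Submodule.comap_coe, Set.mem_preimage, SetLike.mem_coe, hAe]
      exact Submodule.smul_mem _ _ (Submodule.subset_span ⟨i, rfl⟩)
    · intro x hx
      refine (Submodule.span_le (p := (Submodule.span ℂ (Set.range
        (fun i : Fin r => (B ^ (i : ℕ)) v))).comap B)).2 ?_ hx
      rintro _ ⟨i, rfl⟩
      simp only [Submodule.comap_coe, Set.mem_preimage, SetLike.mem_coe]
      rw [← Module.End.mul_apply, ← pow_succ']
      by_cases hi : (i : ℕ) + 1 < r
      · exact Submodule.subset_span ⟨⟨i + 1, hi⟩, rfl⟩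
      · have : (i : ℕ) + 1 = r := by have := i.2; omega
        rw [this, hBr]
        exact Submodule.smul_mem _ _ (Submodule.subset_span ⟨⟨0, hr⟩, by simp⟩)
    · intro hbot
      have : v ∈ Submodule.span ℂ (Set.range (fun i : Fin r => (B ^ (i : ℕ)) v)) :=
        Submodule.subset_span ⟨⟨0, hr⟩, by simp⟩
      rw [hbot] at this
      exact hv0 ((Submodule.mem_bot ℂ).1 this)
  have := Module.finrank_eq_card_basis (Module.Basis.mk hli hspan.ge)
  simpa using this
end
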